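/- arXiv:2603.11822 — 2 statements merged into one kernel-verified Lean document; each statement's English description precedes it below -/
import Mathlib

section
/- Let d ≥ 1 be an integer and let X ⊆ ℝ^d be nonempty, closed and hyperplane diffuse. Then dim_H(X ∩ Bad_d) ≥ dim_L X. -/
open Set Filter MeasureTheory Metric
open scoped ENNReal NNReal

noncomputable section

/-- `T` is a weak tangent of `Y`. -/
def IsWeakTangent {d : ℕ} (Y T : Set (EuclideanSpace ℝ (Fin d))) : Prop :=
  T.Nonempty ∧ IsCompact T ∧
    ∃ (x : ℕ → EuclideanSpace ℝ (Fin d)) (r : ℕ → ℝ),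
      (∀ n, x n ∈ Y) ∧ (∀ n, 0 < r n) ∧ (∀ n, ENNReal.ofReal (r n) ≤ EMetric.diam Y) ∧
      Tendsto
        (fun n => Metric.hausdorffDist
          ((fun y => (r n)⁻¹ • (y - x n)) '' (Y ∩ Metric.closedBall (x n) (r n))) T)
        atTop (nhds 0)

/-- The lower dimension, defined via weak tangents. -/
noncomputable def lowerDim {d : ℕ} (Y : Set (EuclideanSpace ℝ (Fin d))) : ℝ≥0∞ :=
  sInf {s | ∃ T, IsWeakTangent Y T ∧ dimH T = s}

/-- `V` is an affine hyperplane in `ℝ^d`: a level set of a nonzero linear functional. -/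
def IsAffineHyperplane {d : ℕ} (V : Set (EuclideanSpace ℝ (Fin d))) : Prop :=
  ∃ (φ : EuclideanSpace ℝ (Fin d) →ₗ[ℝ] ℝ) (c : ℝ), φ ≠ 0 ∧ V = {x | φ x = c}

/-- `X` is hyperplane diffuse. -/
def HyperplaneDiffuse {d : ℕ} (X : Set (EuclideanSpace ℝ (Fin d))) : Prop :=
  ∃ β : ℝ, 0 < β ∧ ∀ R ∈ Set.Ioo (0:ℝ) 1, ∀ x ∈ X, ∀ V : Set (EuclideanSpace ℝ (Fin d)),
    IsAffineHyperplane V →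
      ((Metric.closedBall x R ∩ X) \ Metric.thickening (β * R) V).Nonempty

/-- The set of badly approximable points in `ℝ^d` (with the Euclidean norm). -/
noncomputable def badApprox (d : ℕ) : Set (EuclideanSpace ℝ (Fin d)) :=
  {x | ∃ c : ℝ, 0 < c ∧ ∀ (p : Fin d → ℤ) (q : ℕ), 1 ≤ q →
    c / (q : ℝ) ^ ((1 : ℝ) + 1 / d) ≤
      ‖x - (WithLp.equiv 2 (Fin d → ℝ)).symm (fun k => (p k : ℝ) / (q : ℝ))‖}


lemma dim_lower {E : Type*} [MetricSpace E] {M : ℕ} (hM : 1 < M) (g : (ℕ → Fin M) → E)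
    (ρ δ : ℝ) (t : ℝ≥0) (hρ0 : 0 < ρ) (hδ : 0 < δ) (ht : 0 < t) (hρ : ρ ^ (t : ℝ) = (M : ℝ)⁻¹)
    (hsep : ∀ ω ω' : ℕ → Fin M, ∀ n, (∀ i < n, ω i = ω' i) → ω n ≠ ω' n →
      δ * ρ ^ n ≤ dist (g ω) (g ω')) : (t : ℝ≥0∞) ≤ dimH (range g) := by
  have key : ∀ ω ω' : ℕ → Fin M, ω ≠ ω' → ∃ n, (∀ i < n, ω i = ω' i) ∧ ω n ≠ ω' n := by
    intro ω ω' hne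
    have hex : ∃ n, ω n ≠ ω' n := by
      by_contra hcon
      push Not at hcon
      exact hne (funext hcon)
    classical
    refine ⟨Nat.find hex, fun i hi => ?_, Nat.find_spec hex⟩
    have := Nat.find_min hex hi
    simpa using this
  have hinj : Function.Injective g := by
    intro ω ω' he
    by_contra hne
    obtain ⟨n, h1, h2⟩ := key ω ω' hne
    have := hsep ω ω' n h1 h2
    rw [he, dist_self] at this
    have : 0 < δ * ρ ^ n := by positivity
    linarith
  have : Nonempty (ℕ → Fin M) := ⟨fun _ => ⟨0, by omega⟩⟩
  let f : E → ℝ := fun z => Real.ofDigits (Function.invFun g z)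
  have hfg : ∀ ω, f (g ω) = Real.ofDigits ω := fun ω => by
    simp only [f, Function.leftInverse_invFun hinj ω]
  have hhol : HolderOnWith (Real.toNNReal ((1 / δ) ^ (t : ℝ))) t f (range g) := by
    rintro _ ⟨ω, rfl⟩ _ ⟨ω', rfl⟩
    rw [hfg, hfg]
    by_cases hne : ω = ω'
    · subst hne; simp
    obtain ⟨n, h1, h2⟩ := key ω ω' hne
    have hd := hsep ω ω' n h1 h2
    have h3 := Real.abs_ofDigits_sub_ofDigits_le h1
    rw [edist_dist, edist_dist, ENNReal.ofReal_rpow_of_nonneg dist_nonneg t.coe_nonneg]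
    change _ ≤ ENNReal.ofReal _ * _
    rw [← ENNReal.ofReal_mul (by positivity)]
    apply ENNReal.ofReal_le_ofReal
    rw [Real.dist_eq]
    refine h3.trans ?_
    rw [← inv_pow, ← hρ, ← Real.mul_rpow (by positivity) dist_nonneg,
      ← Real.rpow_natCast, ← Real.rpow_mul hρ0.le, mul_comm, Real.rpow_mul hρ0.le,
      Real.rpow_natCast]
    apply Real.rpow_le_rpow (by positivity) _ t.coe_nonneg
    rw [one_div, inv_mul_eq_div, le_div_iff₀ hδ]
    linarith
  have himg : Icc (0:ℝ) 1 ⊆ f '' range g := by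
    intro y hy
    obtain ⟨ω, -, hω⟩ := Real.ofDigits_SurjOn hM hy
    exact ⟨g ω, ⟨ω, rfl⟩, by rw [hfg, hω]⟩
  have h1 : (1 : ℝ≥0∞) ≤ dimH (range g) / t := by
    calc (1 : ℝ≥0∞) = dimH (Icc (0:ℝ) 1) := by
          rw [Real.dimH_of_mem_nhds (Icc_mem_nhds (show (0:ℝ) < 1/2 by norm_num) (by norm_num))]
          simp
      _ ≤ dimH (f '' range g) := dimH_mono himg
      _ ≤ _ := hhol.dimH_image_le ht
  rw [ENNReal.le_div_iff_mul_le (by simp [ht.ne']) (by simp)] at h1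
  simpa using h1

lemma det_simplex {d : ℕ} (hd : 1 ≤ d) (x : Fin d → ℝ) (R : ℝ) (hR : 0 < R)
    (p : Fin (d+1) → Fin d → ℤ) (q : Fin (d+1) → ℕ) (hq : ∀ i, 1 ≤ q i)
    (hqR : ∀ i, R * (q i : ℝ) ^ ((1 : ℝ) + 1 / d) < 1 / (2 * (d+1).factorial))
    (hx : ∀ i k, |(p i k : ℝ) / q i - x k| ≤ 2 * R) :
    (Matrix.of (fun i => (Fin.cons (q i : ℝ) (fun k => (p i k : ℝ)) : Fin (d+1) → ℝ))).det = 0 := by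
  have hqpos : ∀ i, (0:ℝ) < q i := fun i => by exact_mod_cast hq i
  set N := (Matrix.of (fun i => (Fin.cons (q i : ℝ) (fun k => (p i k : ℝ)) : Fin (d+1) → ℝ)))
    with hN
  let NZ : Matrix (Fin (d+1)) (Fin (d+1)) ℤ :=
    Matrix.of (fun i => (Fin.cons (q i : ℤ) (fun k => p i k) : Fin (d+1) → ℤ))
  have hNZ : N.det = (NZ.det : ℝ) := by
    have h1 : N = NZ.map (Int.castRingHom ℝ) := by
      ext i j
      refine Fin.cases ?_ (fun k => ?_) j <;> simp [N, NZ]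
    rw [h1, ← RingHom.mapMatrix_apply, ← RingHom.map_det]
    simp
  let B : Matrix (Fin (d+1)) (Fin (d+1)) ℝ :=
    Matrix.of (fun i => (Fin.cons 1 (fun k => ((p i k : ℝ) / q i - x k) / (2 * R)) : Fin (d+1) → ℝ))
  let U : Matrix (Fin (d+1)) (Fin (d+1)) ℝ :=
    Matrix.of (fun i j => (Fin.cons (Fin.cons 1 x : Fin (d+1) → ℝ)
      (fun l => (Fin.cons 0 (fun k => if l = k then 2 * R else 0) : Fin (d+1) → ℝ)) :
        Fin (d+1) → Fin (d+1) → ℝ) i j)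
  have hfac : N = Matrix.diagonal (fun i => (q i : ℝ)) * (B * U) := by
    ext i j
    have := (hqpos i).ne'
    rw [Matrix.diagonal_mul, Matrix.mul_apply, Fin.sum_univ_succ]
    refine Fin.cases ?_ (fun k => ?_) j
    · simp [N, B, U]
    · simp [N, B, U]
      field_simp
      ring
  have hU : U.det = (2 * R) ^ d := by
    rw [Matrix.det_of_isUpperTriangular]
    · rw [Fin.prod_univ_succ]
      simp [U]
    · intro i j hij
      simp only [id] at hij
      induction i using Fin.cases with
      | zero => exact absurd hij (by simp)
      | succ i =>
        induction j using Fin.cases with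
        | zero => simp [U]
        | succ j =>
          have : i ≠ j := by rintro rfl; simp at hij
          simp [U, this]
  have hB : |B.det| ≤ (d+1).factorial := by
    have := Matrix.det_le (A := B) (abv := AbsoluteValue.abs) (x := (1:ℝ)) (by
      intro i j
      refine Fin.cases ?_ (fun k => ?_) j
      · simp [B]
      · simp only [B, Matrix.of_apply, Fin.cons_succ, AbsoluteValue.abs_apply]
        rw [abs_div, abs_of_pos (show 0 < 2 * R by positivity), div_le_one (by positivity)]
        exact hx i k)
    simpa using this
  have hdpos : (0:ℝ) < d := by exact_mod_cast hd
  have hprod : ∏ i, (q i : ℝ) < (1 / (2 * (d+1).factorial * R)) ^ d := by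
    have hη : (0:ℝ) < 1 / (2 * (d+1).factorial * R) := by positivity
    have h1 : ∀ i, (q i : ℝ) ^ (d+1) < (1 / (2 * (d+1).factorial * R)) ^ d := by
      intro i
      have h2 : (q i : ℝ) ^ ((1 : ℝ) + 1 / d) < 1 / (2 * (d+1).factorial * R) := by
        have := hqR i
        rw [lt_div_iff₀ (by positivity)] at this ⊢
        linarith
      have h3 : ((q i : ℝ) ^ ((1 : ℝ) + 1 / d)) ^ d = (q i : ℝ) ^ (d+1) := by
        rw [← Real.rpow_natCast, ← Real.rpow_mul (hqpos i).le, ← Real.rpow_natCast]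
        congr 1
        push_cast
        field_simp
      rw [← h3]
      exact pow_lt_pow_left₀ h2 (by positivity) (by omega)
    have h4 : (∏ i, (q i : ℝ)) ^ (d+1) < ((1 / (2 * (d+1).factorial * R)) ^ d) ^ (d+1) := by
      rw [← Finset.prod_pow]
      calc ∏ i, (q i : ℝ) ^ (d+1) < ∏ i : Fin (d+1), ((1 / (2 * (d+1).factorial * R)) ^ d : ℝ) :=
            Finset.prod_lt_prod_of_nonempty (fun i _ => pow_pos (hqpos i) _) (fun i _ => h1 i)
              Finset.univ_nonempty
        _ = _ := by simp
    exact lt_of_pow_lt_pow_left₀ _ (by positivity) h4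
  have hlt : |N.det| < 1 := by
    rw [hfac, Matrix.det_mul, Matrix.det_mul, Matrix.det_diagonal, hU, abs_mul, abs_mul,
      abs_of_pos (Finset.prod_pos (fun i _ => hqpos i)),
      abs_of_pos (show 0 < (2 * R) ^ d by positivity)]
    have hf1 : (1:ℝ) ≤ (d+1).factorial := by exact_mod_cast Nat.one_le_iff_ne_zero.2 (Nat.factorial_ne_zero _)
    calc (∏ i, (q i : ℝ)) * (|B.det| * (2 * R) ^ d)
        ≤ (∏ i, (q i : ℝ)) * ((d+1).factorial * (2 * R) ^ d) := by
          have : 0 ≤ ∏ i, (q i : ℝ) := (Finset.prod_pos (fun i _ => hqpos i)).le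
          gcongr
      _ < (1 / (2 * (d+1).factorial * R)) ^ d * ((d+1).factorial * (2 * R) ^ d) := by
          gcongr
      _ ≤ (1 / (2 * (d+1).factorial * R)) ^ d * (((d+1).factorial : ℝ) ^ d * (2 * R) ^ d) := by
          gcongr
          exact le_self_pow₀ hf1 (by omega)
      _ = 1 := by
          rw [← mul_pow, ← mul_pow]
          have : (1 / (2 * (d+1).factorial * R)) * (((d+1).factorial : ℝ) * (2 * R)) = 1 := by
            field_simp
          rw [this, one_pow]
  rw [hNZ] at hlt ⊢
  have : |NZ.det| < 1 := by exact_mod_cast hlt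
  rw [Int.abs_lt_one_iff] at this
  simp [this]

lemma simplex_lemma {d : ℕ} (hd : 1 ≤ d) (x : EuclideanSpace ℝ (Fin d)) (R : ℝ) (hR : 0 < R) :
    ∃ V : Set (EuclideanSpace ℝ (Fin d)), IsAffineHyperplane V ∧
      ∀ (p : Fin d → ℤ) (q : ℕ), 1 ≤ q →
        R * (q : ℝ) ^ ((1 : ℝ) + 1 / d) < 1 / (2 * (d+1).factorial) →
        dist ((WithLp.equiv 2 (Fin d → ℝ)).symm (fun k => (p k : ℝ) / (q : ℝ))) x ≤ 2 * R →
        (WithLp.equiv 2 (Fin d → ℝ)).symm (fun k => (p k : ℝ) / (q : ℝ)) ∈ V := by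
  let G : Set ((Fin d → ℤ) × ℕ) := {a | 1 ≤ a.2 ∧
    R * (a.2 : ℝ) ^ ((1 : ℝ) + 1 / d) < 1 / (2 * (d+1).factorial) ∧
    dist ((WithLp.equiv 2 (Fin d → ℝ)).symm (fun k => (a.1 k : ℝ) / (a.2 : ℝ))) x ≤ 2 * R}
  let v : (Fin d → ℤ) × ℕ → Fin (d+1) → ℝ :=
    fun a => (Fin.cons (a.2 : ℝ) (fun k => (a.1 k : ℝ)) : Fin (d+1) → ℝ)
  have hspan : Submodule.span ℝ (v '' G) < ⊤ := by
    rw [lt_top_iff_ne_top]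
    intro htop
    obtain ⟨b, hb, hbs, hbl⟩ := exists_linearIndependent ℝ (v '' G)
    have hbas : Module.Basis b ℝ (Fin (d+1) → ℝ) := Module.Basis.mk hbl (by
      rw [Subtype.range_coe, hbs, htop])
    have : Fintype b := FiniteDimensional.fintypeBasisIndex hbas
    have hcard : Fintype.card b = Fintype.card (Fin (d+1)) := by
      rw [← Module.finrank_eq_card_basis hbas]; simp
    let e : Fin (d+1) ≃ b := (Fintype.equivOfCardEq hcard).symm
    have hlin : LinearIndependent ℝ (fun i => ((e i : b) : Fin (d+1) → ℝ)) :=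
      hbl.comp e e.injective
    have hch : ∀ i, ∃ a ∈ G, v a = (e i : Fin (d+1) → ℝ) := fun i => hb (e i).2
    choose a haG hav using hch
    have hdet := det_simplex hd x R hR (fun i => (a i).1) (fun i => (a i).2)
      (fun i => (haG i).1) (fun i => (haG i).2.1) (by
        intro i k
        have h1 := (haG i).2.2
        rw [dist_eq_norm] at h1
        have h2 := PiLp.norm_apply_le (((WithLp.equiv 2 (Fin d → ℝ)).symm
          (fun k => ((a i).1 k : ℝ) / ((a i).2 : ℝ))) - x) k
        refine le_trans ?_ (h2.trans h1)
        simp)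
    have hrow : (Matrix.of (fun i => v (a i))).row = fun i => ((e i : b) : Fin (d+1) → ℝ) := by
      funext i; exact hav i
    have hu : IsUnit (Matrix.of (fun i => v (a i))) := by
      rw [← Matrix.linearIndependent_rows_iff_isUnit, hrow]
      exact hlin
    rw [Matrix.isUnit_iff_isUnit_det] at hu
    exact hu.ne_zero hdet
  obtain ⟨f, hf0, hf⟩ := Submodule.exists_le_ker_of_lt_top _ hspan
  by_cases hG : G.Nonempty
  · let L : EuclideanSpace ℝ (Fin d) →ₗ[ℝ] (Fin (d+1) → ℝ) :=
      { toFun := fun y => (Fin.cons 0 (fun k => y k) : Fin (d+1) → ℝ)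
        map_add' := by
          intro y z; ext j; refine Fin.cases ?_ (fun k => ?_) j <;> simp
        map_smul' := by
          intro y z; ext j; refine Fin.cases ?_ (fun k => ?_) j <;> simp }
    let e0 : Fin (d+1) → ℝ := Fin.cons 1 (fun _ => 0)
    have hdec : ∀ w : Fin (d+1) → ℝ, w = w 0 • e0 + L (WithLp.toLp 2 (fun k => w k.succ)) := by
      intro w; ext j; refine Fin.cases ?_ (fun k => ?_) j <;> simp [e0, L]
    have hrel : ∀ a ∈ G, f (L ((WithLp.equiv 2 (Fin d → ℝ)).symm
        (fun k => (a.1 k : ℝ) / (a.2 : ℝ)))) = - f e0 := by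
      intro a ha
      have hq : (0:ℝ) < a.2 := by exact_mod_cast ha.1
      have h1 : f (v a) = 0 := hf (Submodule.subset_span ⟨a, ha, rfl⟩)
      have h2 : v a = (a.2 : ℝ) • (e0 + L ((WithLp.equiv 2 (Fin d → ℝ)).symm
        (fun k => (a.1 k : ℝ) / (a.2 : ℝ)))) := by
        ext j
        refine Fin.cases ?_ (fun k => ?_) j
        · simp [v, e0, L]
        · simp [v, e0, L]; field_simp
      rw [h2, map_smul, smul_eq_mul, map_add] at h1
      rcases mul_eq_zero.1 h1 with h | h
      · exact absurd h hq.ne'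
      · linarith
    refine ⟨{y | (f ∘ₗ L) y = - f e0}, ⟨f ∘ₗ L, - f e0, ?_, rfl⟩, ?_⟩
    · intro hz
      obtain ⟨a, ha⟩ := hG
      have h1 := hrel a ha
      have h2 : ∀ y, f (L y) = 0 := fun y => by
        have := LinearMap.congr_fun hz y
        simpa using this
      rw [h2] at h1
      apply hf0
      ext1 w
      apply LinearMap.ext
      intro u
      rw [LinearMap.comp_apply, hdec (LinearMap.single ℝ _ w u), map_add, h2, map_smul]
      have : f e0 = 0 := by linarith
      simp [this]
    · intro p q h1 h2 h3
      exact hrel (p, q) ⟨h1, h2, h3⟩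
  · let φ : EuclideanSpace ℝ (Fin d) →ₗ[ℝ] ℝ :=
      { toFun := fun y => y ⟨0, hd⟩
        map_add' := by intro y z; simp
        map_smul' := by intro y z; simp }
    refine ⟨{y | φ y = 0}, ⟨φ, 0, ?_, rfl⟩, ?_⟩
    · intro hz
      have : (1:ℝ) = 0 := LinearMap.congr_fun hz (WithLp.toLp 2 (fun _ => 1))
      norm_num at this
    · intro p q h1 h2 h3
      exact absurd ⟨(p, q), h1, h2, h3⟩ hG

lemma exists_net {E : Type*} [PseudoMetricSpace E] (T : Set E) (δ : ℝ) (hδ : 0 ≤ δ) (N : ℕ)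
    (hN : ∀ F : Finset E, (F : Set E) ⊆ T → (∀ y ∈ F, ∀ z ∈ F, y ≠ z → δ ≤ dist y z) →
      F.card ≤ N) :
    ∃ F : Finset E, (F : Set E) ⊆ T ∧ (∀ y ∈ F, ∀ z ∈ F, y ≠ z → δ ≤ dist y z) ∧
      T ⊆ ⋃ y ∈ F, closedBall y δ := by
  classical
  let S : Set ℕ := {n | ∃ F : Finset E, (F : Set E) ⊆ T ∧
    (∀ y ∈ F, ∀ z ∈ F, y ≠ z → δ ≤ dist y z) ∧ F.card = n}
  have hSne : S.Nonempty := ⟨0, ∅, by simp, by simp, by simp⟩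
  have hSb : BddAbove S := ⟨N, by rintro n ⟨F, h1, h2, rfl⟩; exact hN F h1 h2⟩
  obtain ⟨F, h1, h2, h3⟩ := Nat.sSup_mem hSne hSb
  refine ⟨F, h1, h2, fun z hz => ?_⟩
  by_contra hcon
  simp only [mem_iUnion, mem_closedBall, not_exists, not_le] at hcon
  have hzF : z ∉ F := fun hzF => by
    have hlt := hcon z hzF
    rw [dist_self] at hlt
    linarith
  have hmem : (insert z F).card ∈ S := by
    refine ⟨insert z F, ?_, ?_, rfl⟩
    · intro w hw
      rcases Finset.mem_insert.1 hw with rfl | hw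
      · exact hz
      · exact h1 hw
    · intro y hy w hw hne
      rcases Finset.mem_insert.1 hy with rfl | hy' <;> rcases Finset.mem_insert.1 hw with rfl | hw'
      · exact absurd rfl hne
      · exact (hcon w hw').le
      · rw [dist_comm]; exact (hcon y hy').le
      · exact h2 y hy' w hw' hne
  have := le_csSup hSb hmem
  rw [Finset.card_insert_of_notMem hzF, h3] at this
  omega

lemma hausdorff_finite {E : Type*} [MetricSpace E] [MeasurableSpace E] [BorelSpace E]
    (T : Set E) (s : ℝ≥0) (C ρ0 : ℝ) (hρ0 : 0 < ρ0)
    (hT : ∀ ρ : ℝ, 0 < ρ → ρ ≤ ρ0 → ∀ F : Finset E, (F : Set E) ⊆ T →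
      (∀ y ∈ F, ∀ z ∈ F, y ≠ z → 2 * ρ ≤ dist y z) → (F.card : ℝ) ≤ C * ρ ^ (-(s:ℝ))) :
    μH[(s:ℝ)] T ≠ ⊤ := by
  let ρ : ℕ → ℝ := fun n => ρ0 / (n + 1)
  have hρpos : ∀ n, 0 < ρ n := fun n => by positivity
  have hρle : ∀ n, ρ n ≤ ρ0 := fun n => div_le_self hρ0.le (by linarith [Nat.cast_nonneg (α := ℝ) n])
  have hnet : ∀ n, ∃ F : Finset E, (F : Set E) ⊆ T ∧
      (∀ y ∈ F, ∀ z ∈ F, y ≠ z → 2 * ρ n ≤ dist y z) ∧ T ⊆ ⋃ y ∈ F, closedBall y (2 * ρ n) := by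
    intro n
    refine exists_net T (2 * ρ n) (by linarith [hρpos n]) ⌊C * (ρ n) ^ (-(s:ℝ))⌋₊ ?_ 
    intro F h1 h2
    exact Nat.le_floor (hT _ (hρpos n) (hρle n) F h1 h2)
  choose F hF1 hF2 hF3 using hnet
  have hlim : Tendsto (fun n => ENNReal.ofReal (4 * ρ n)) atTop (nhds 0) := by
    have h1 : Tendsto ρ atTop (nhds 0) := by
      have := (tendsto_one_div_add_atTop_nhds_zero_nat (𝕜 := ℝ)).const_mul ρ0
      simpa [ρ, div_eq_mul_inv] using this
    have h2 := ENNReal.tendsto_ofReal (h1.const_mul 4)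
    simpa using h2
  have hdiam : ∀ n (i : F n), Metric.ediam (closedBall (i : E) (2 * ρ n)) ≤ ENNReal.ofReal (4 * ρ n) := by
    intro n i
    have : ENNReal.ofReal (4 * ρ n) = 2 * ENNReal.ofReal (2 * ρ n) := by
      rw [show (2:ℝ≥0∞) = ENNReal.ofReal 2 by simp, ← ENNReal.ofReal_mul (by norm_num)]
      ring_nf
    rw [this, ← Metric.closedEBall_ofReal (by linarith [hρpos n])]
    exact Metric.ediam_closedEBall_le
  have hle := Measure.hausdorffMeasure_le_liminf_sum (s:ℝ) T (l := atTop)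
    (fun n => ENNReal.ofReal (4 * ρ n)) hlim (ι := fun n => F n)
    (fun n i => closedBall (i : E) (2 * ρ n))
    (Eventually.of_forall hdiam)
    (Eventually.of_forall (fun n => by
      have := hF3 n
      rw [Set.iUnion_subtype]
      exact this))
  have hsum : ∀ n, ∑ i : F n, Metric.ediam (closedBall (i : E) (2 * ρ n)) ^ (s:ℝ) ≤
      ENNReal.ofReal (C * 4 ^ (s:ℝ)) := by
    intro n
    calc ∑ i : F n, Metric.ediam (closedBall (i : E) (2 * ρ n)) ^ (s:ℝ)
        ≤ ∑ i : F n, ENNReal.ofReal (4 * ρ n) ^ (s:ℝ) :=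
          Finset.sum_le_sum (fun i _ => ENNReal.rpow_le_rpow (hdiam n i) s.coe_nonneg)
      _ = ENNReal.ofReal ((F n).card * (4 * ρ n) ^ (s:ℝ)) := by
          rw [ENNReal.ofReal_mul (p := ((F n).card : ℝ)) (by positivity),
            ENNReal.ofReal_rpow_of_nonneg (by linarith [hρpos n]) s.coe_nonneg]
          simp
      _ ≤ _ := by
          apply ENNReal.ofReal_le_ofReal
          have h1 := hT _ (hρpos n) (hρle n) (F n) (hF1 n) (hF2 n)
          calc ((F n).card : ℝ) * (4 * ρ n) ^ (s:ℝ) ≤ (C * (ρ n) ^ (-(s:ℝ))) * (4 * ρ n) ^ (s:ℝ) := by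
                have := hρpos n
                gcongr
            _ = C * 4 ^ (s:ℝ) := by
                rw [Real.mul_rpow (by norm_num) (hρpos n).le, Real.rpow_neg (hρpos n).le]
                have := (Real.rpow_pos_of_pos (hρpos n) (s:ℝ)).ne'
                field_simp
  have h2 := hle.trans ((liminf_le_liminf (Eventually.of_forall hsum)).trans
    (liminf_const _).le)
  exact ne_top_of_le_ne_top ENNReal.ofReal_ne_top h2

lemma step_sep {d : ℕ} (X : Set (EuclideanSpace ℝ (Fin d))) (hcl : IsClosed X) (s : ℝ≥0)
    (hs : (s : ℝ≥0∞) < lowerDim X) (R0 : ℝ) (hR0 : ENNReal.ofReal R0 ≤ EMetric.diam X)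
    (C ρ0 : ℝ) (hρ0 : 0 < ρ0) :
    ∃ ε : ℝ, 0 < ε ∧ ∀ x ∈ X, ∀ R : ℝ, 0 < R → R ≤ R0 → ∃ ρ : ℝ, ε ≤ ρ ∧ ρ ≤ ρ0 ∧
      ∃ F : Finset (EuclideanSpace ℝ (Fin d)), (F : Set (EuclideanSpace ℝ (Fin d))) ⊆ X ∧
        (∀ y ∈ F, dist y x ≤ R) ∧ (∀ y ∈ F, ∀ z ∈ F, y ≠ z → ρ * R ≤ dist y z) ∧
        C * ρ ^ (-(s:ℝ)) ≤ F.card := by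
  by_contra hcon
  push Not at hcon
  have hc := fun n : ℕ => hcon (1 / ((n:ℝ) + 1)) (by positivity)
  choose x hxX R hRpos hRle hbad using hc
  let E := EuclideanSpace ℝ (Fin d)
  let Φ : ℕ → E → E := fun n y => (R n)⁻¹ • (y - x n)
  let A : ℕ → Set E := fun n => Φ n '' (X ∩ closedBall (x n) (R n))
  have hAc : ∀ n, IsCompact (A n) := fun n => by
    apply IsCompact.image
    · exact (isCompact_closedBall _ _).inter_left hcl
    · fun_prop
  have hAne : ∀ n, (A n).Nonempty := fun n =>
    ⟨_, mem_image_of_mem _ ⟨hxX n, mem_closedBall_self (hRpos n).le⟩⟩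
  have hAsub : ∀ n, A n ⊆ closedBall (0:E) 1 := by
    rintro n _ ⟨y, ⟨-, hy⟩, rfl⟩
    rw [mem_closedBall_zero_iff, norm_smul, norm_inv, Real.norm_of_nonneg (hRpos n).le,
      inv_mul_eq_div, div_le_one (hRpos n), ← dist_eq_norm]
    exact hy
  let K : ℕ → TopologicalSpace.NonemptyCompacts (closedBall (0:E) 1) := fun n =>
    ⟨⟨Subtype.val ⁻¹' A n, ((hAc n).isClosed.preimage continuous_subtype_val).isCompact⟩, by
      obtain ⟨a, ha⟩ := hAne n
      exact ⟨⟨a, hAsub n ha⟩, ha⟩⟩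
  have hKA : ∀ n, Subtype.val '' (K n : Set (closedBall (0:E) 1)) = A n := fun n => by
    change Subtype.val '' (Subtype.val ⁻¹' A n) = A n
    rw [Subtype.image_preimage_coe]
    exact inter_eq_right.2 (hAsub n)
  obtain ⟨Kl, φ, hφ, hlim⟩ := CompactSpace.tendsto_subseq K
  let T : Set E := Subtype.val '' (Kl : Set (closedBall (0:E) 1))
  have hTc : IsCompact T := Kl.isCompact.image continuous_subtype_val
  have hTne : T.Nonempty := Kl.nonempty.image _
  have hdlim : Tendsto (fun n => hausdorffDist (A (φ n)) T) atTop (nhds 0) := by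
    have h1 := tendsto_iff_dist_tendsto_zero.1 hlim
    refine h1.congr (fun n => ?_)
    rw [Metric.NonemptyCompacts.dist_eq, ← hausdorffDist_image isometry_subtype_coe]
    simp only [Function.comp, hKA]
    rfl
  have hTw : IsWeakTangent X T := by
    refine ⟨hTne, hTc, fun n => x (φ n), fun n => R (φ n), fun n => hxX _, fun n => hRpos _,
      fun n => ?_, hdlim⟩
    exact (ENNReal.ofReal_le_ofReal (hRle _)).trans hR0
  have hdim : (s : ℝ≥0∞) < dimH T := lt_of_lt_of_le hs (sInf_le ⟨T, hTw, rfl⟩)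
  borelize E
  refine hausdorff_finite T s C ρ0 hρ0 ?_ (hausdorffMeasure_of_lt_dimH hdim)
  intro ρ hρ hρle F hFT hFsep
  have hev : ∀ᶠ n in atTop, hausdorffDist (A (φ n)) T < ρ / 2 :=
    hdlim.eventually (gt_mem_nhds (by positivity))
  have hev2 : ∀ᶠ n in atTop, 1 / (((φ n : ℕ):ℝ) + 1) < ρ :=
    ((tendsto_one_div_add_atTop_nhds_zero_nat (𝕜 := ℝ)).comp hφ.tendsto_atTop).eventually
      (gt_mem_nhds hρ)
  obtain ⟨n, hn1, hn2⟩ := (hev.and hev2).exists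
  have hfin : hausdorffEDist (A (φ n)) T ≠ ⊤ :=
    hausdorffEDist_ne_top_of_nonempty_of_bounded (hAne _) hTne (hAc _).isBounded hTc.isBounded
  have hch : ∀ y : E, ∃ z : E, y ∈ F → (z ∈ X ∧ dist z (x (φ n)) ≤ R (φ n) ∧
      dist (Φ (φ n) z) y < ρ / 2) := by
    intro y
    by_cases hy : y ∈ F
    · obtain ⟨w, ⟨z, ⟨hz1, hz2⟩, rfl⟩, hw⟩ :=
        exists_dist_lt_of_hausdorffDist_lt' (hFT hy) hn1 hfin
      exact ⟨z, fun _ => ⟨hz1, hz2, hw⟩⟩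
    · exact ⟨0, fun h => absurd h hy⟩
  choose g hg using hch
  have hΦ : ∀ z w, dist (Φ (φ n) z) (Φ (φ n) w) * R (φ n) = dist z w := by
    intro z w
    have hR := hRpos (φ n)
    simp only [Φ]
    rw [dist_smul₀, dist_sub_right, norm_inv, Real.norm_of_nonneg hR.le]
    field_simp
  have hsep : ∀ y ∈ F, ∀ z ∈ F, y ≠ z → ρ * R (φ n) ≤ dist (g y) (g z) := by
    intro y hy z hz hne
    rw [← hΦ]
    have h1 := (hg y hy).2.2
    have h2 := (hg z hz).2.2
    have h3 := hFsep y hy z hz hne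
    have h4 := dist_triangle4 y (Φ (φ n) (g y)) (Φ (φ n) (g z)) z
    rw [dist_comm y (Φ (φ n) (g y))] at h4
    have := hRpos (φ n)
    gcongr
    linarith
  classical
  have hinj : Set.InjOn g F := by
    intro y hy z hz he
    by_contra hne
    have := hsep y hy z hz hne
    rw [he, dist_self] at this
    have : 0 < ρ * R (φ n) := mul_pos hρ (hRpos _)
    linarith
  have := hbad (φ n) ρ hn2.le hρle (F.image g) (by
      intro w hw
      obtain ⟨y, hy, rfl⟩ := Finset.mem_image.1 hw
      exact (hg y hy).1) (by
      intro w hw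
      obtain ⟨y, hy, rfl⟩ := Finset.mem_image.1 hw
      exact (hg y hy).2.1) (by
      intro w hw w' hw' hne
      obtain ⟨y, hy, rfl⟩ := Finset.mem_image.1 hw
      obtain ⟨z, hz, rfl⟩ := Finset.mem_image.1 hw'
      exact hsep y hy z hz (fun h => hne (by rw [h])))
  rw [Finset.card_image_of_injOn hinj] at this
  exact this.le

/-- Uniform lower bound for separated sets. -/
lemma uniform_sep {E : Type*} [MetricSpace E] (X : Set E) (s : ℝ≥0) (R0 : ℝ)
    (hstep : ∃ ε : ℝ, 0 < ε ∧ ∀ x ∈ X, ∀ R : ℝ, 0 < R → R ≤ R0 → ∃ ρ : ℝ, ε ≤ ρ ∧ ρ ≤ 1 ∧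
      ∃ F : Finset E, (F : Set E) ⊆ X ∧
        (∀ y ∈ F, dist y x ≤ R) ∧ (∀ y ∈ F, ∀ z ∈ F, y ≠ z → ρ * R ≤ dist y z) ∧
        8 ^ (s:ℝ) * ρ ^ (-(s:ℝ)) ≤ F.card) :
    ∃ c : ℝ, 0 < c ∧ ∀ x ∈ X, ∀ R : ℝ, 0 < R → R ≤ R0 → ∀ r : ℝ, 0 < r →
      ∃ F : Finset E, (F : Set E) ⊆ X ∧
        (∀ y ∈ F, dist y x ≤ R) ∧ (∀ y ∈ F, ∀ z ∈ F, y ≠ z → r ≤ dist y z) ∧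
        c * (R / r) ^ (s:ℝ) ≤ F.card := by
  classical
  obtain ⟨ε, hε, H⟩ := hstep
  refine ⟨(4 / ε) ^ (-(s:ℝ)), by positivity, ?_⟩
  intro x hx R hR hRR r hr
  obtain ⟨k, hk⟩ : ∃ k : ℕ, R / r ≤ 2 ^ k :=
    (pow_unbounded_of_one_lt (R / r) (by norm_num : (1:ℝ) < 2)).imp (fun k h => h.le)
  have hmain : ∀ k : ℕ, ∀ x ∈ X, ∀ R : ℝ, 0 < R → R ≤ R0 → R / r ≤ 4 / ε * 2 ^ k →
      ∃ F : Finset E, (F : Set E) ⊆ X ∧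
        (∀ y ∈ F, dist y x ≤ R) ∧ (∀ y ∈ F, ∀ z ∈ F, y ≠ z → r ≤ dist y z) ∧
        (4 / ε) ^ (-(s:ℝ)) * (R / r) ^ (s:ℝ) ≤ F.card := by
    have hsmall : ∀ x ∈ X, ∀ R : ℝ, 0 < R → R ≤ R0 → R / r ≤ 4 / ε →
      ∃ F : Finset E, (F : Set E) ⊆ X ∧
        (∀ y ∈ F, dist y x ≤ R) ∧ (∀ y ∈ F, ∀ z ∈ F, y ≠ z → r ≤ dist y z) ∧
        (4 / ε) ^ (-(s:ℝ)) * (R / r) ^ (s:ℝ) ≤ F.card := by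
      intro x hx R hR hRR hle
      refine ⟨{x}, by simpa using hx, by simp [hR.le], by simp, ?_⟩
      have h1 : (R / r) ^ (s:ℝ) ≤ (4 / ε) ^ (s:ℝ) :=
        Real.rpow_le_rpow (by positivity) hle s.coe_nonneg
      rw [Real.rpow_neg (by positivity), inv_mul_eq_div]
      have : (0:ℝ) < (4 / ε) ^ (s:ℝ) := by positivity
      rw [div_le_iff₀ this]
      simpa using h1
    intro k
    induction k with
    | zero =>
      intro x hx R hR hRR hle
      exact hsmall x hx R hR hRR (by simpa using hle)
    | succ k ih =>
      intro x hx R hR hRR hle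
      by_cases hsm : R / r ≤ 4 / ε
      · exact hsmall x hx R hR hRR hsm
      push Not at hsm
      rw [div_lt_div_iff₀ hε hr] at hsm
      obtain ⟨ρ, hρ1, hρ2, F0, hF0X, hF0d, hF0s, hF0c⟩ := H x hx (R / 2) (by positivity) (by linarith)
      have hρ : 0 < ρ := lt_of_lt_of_le hε hρ1
      have hρR : ρ * R ≤ R := by nlinarith
      have hch : ∀ y : E, ∃ F : Finset E, y ∈ F0 → ((F : Set E) ⊆ X ∧
          (∀ z ∈ F, dist z y ≤ ρ * R / 8) ∧ (∀ w ∈ F, ∀ z ∈ F, w ≠ z → r ≤ dist w z) ∧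
          (4 / ε) ^ (-(s:ℝ)) * (ρ * R / 8 / r) ^ (s:ℝ) ≤ F.card) := by
        intro y
        by_cases hy : y ∈ F0
        · obtain ⟨F, hF⟩ := ih y (hF0X hy) (ρ * R / 8) (by positivity) (by linarith) (by
            calc ρ * R / 8 / r ≤ R / 2 / r := by gcongr; linarith
              _ = (R / r) / 2 := by ring
              _ ≤ (4 / ε * 2 ^ (k+1)) / 2 := by gcongr
              _ = _ := by ring)
          exact ⟨F, fun _ => hF⟩
        · exact ⟨∅, fun h => absurd h hy⟩
      choose G hG using hch
      have hcross : ∀ y ∈ F0, ∀ y' ∈ F0, y ≠ y' → ∀ z ∈ G y, ∀ z' ∈ G y', r ≤ dist z z' := by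
        intro y hy y' hy' hne z hz z' hz'
        have h1 := hF0s y hy y' hy' hne
        have h2 := (hG y hy).2.1 z hz
        have h3 := (hG y' hy').2.1 z' hz'
        have h4 := dist_triangle4 y z z' y'
        rw [dist_comm y z] at h4
        have h5 : 4 * r ≤ ρ * R := by nlinarith
        linarith
      refine ⟨F0.biUnion G, ?_, ?_, ?_, ?_⟩
      · intro z hz
        obtain ⟨y, hy, hz⟩ := Finset.mem_biUnion.1 hz
        exact (hG y hy).1 hz
      · intro z hz
        obtain ⟨y, hy, hz⟩ := Finset.mem_biUnion.1 hz
        have h2 := (hG y hy).2.1 z hz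
        have h3 := hF0d y hy
        have := dist_triangle z y x
        linarith
      · intro z hz z' hz' hne
        obtain ⟨y, hy, hz⟩ := Finset.mem_biUnion.1 hz
        obtain ⟨y', hy', hz'⟩ := Finset.mem_biUnion.1 hz'
        by_cases he : y = y'
        · subst he
          exact (hG y hy).2.2.1 z hz z' hz' hne
        · exact hcross y hy y' hy' he z hz z' hz'
      · rw [Finset.card_biUnion]
        · push_cast
          have h1 : (4 / ε) ^ (-(s:ℝ)) * (R / r) ^ (s:ℝ) =
              (8 ^ (s:ℝ) * ρ ^ (-(s:ℝ))) * ((4 / ε) ^ (-(s:ℝ)) * (ρ * R / 8 / r) ^ (s:ℝ)) := by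
            rw [show ρ * R / 8 / r = ρ * (R / r) / 8 by ring,
              Real.div_rpow (x := ρ * (R / r)) (by positivity) (by norm_num),
              Real.mul_rpow hρ.le (by positivity), Real.rpow_neg hρ.le]
            have := (Real.rpow_pos_of_pos hρ (s:ℝ)).ne'
            field_simp
          rw [h1]
          calc _ ≤ (F0.card : ℝ) * ((4 / ε) ^ (-(s:ℝ)) * (ρ * R / 8 / r) ^ (s:ℝ)) := by gcongr
            _ = ∑ y ∈ F0, ((4 / ε) ^ (-(s:ℝ)) * (ρ * R / 8 / r) ^ (s:ℝ)) := by simp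
            _ ≤ _ := Finset.sum_le_sum (fun y hy => (hG y hy).2.2.2)
        · intro y hy y' hy' hne
          change Disjoint (G y) (G y')
          rw [Finset.disjoint_left]
          intro z hz hz'
          have := hcross y hy y' hy' hne z hz z hz'
          rw [dist_self] at this
          linarith
  by_cases h4 : (1:ℝ) ≤ 4 / ε
  · refine hmain k x hx R hR hRR (hk.trans ?_)
    exact le_mul_of_one_le_left (by positivity) h4
  · obtain ⟨k, hk⟩ := pow_unbounded_of_one_lt (R / r / (4 / ε)) (by norm_num : (1:ℝ) < 2)
    refine hmain k x hx R hR hRR ?_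
    rw [div_lt_iff₀ (by positivity)] at hk
    linarith

/-- The tree construction. -/
lemma tree_dim {E : Type*} [MetricSpace E] [CompleteSpace E] (X : Set E) (hcl : IsClosed X)
    (hne : X.Nonempty) {ι : Type*} (P : ι → E) (A : ι → ℝ) (hA : ∀ a, 1 ≤ A a)
    {M : ℕ} (hM : 1 < M) (ρ r0 κ η : ℝ) (t : ℝ≥0) (hρ0 : 0 < ρ) (hρ2 : ρ ≤ 1 / 2) (hr0 : 0 < r0)
    (hκ : 0 < κ) (hη : 0 < η) (ht : 0 < t) (hρ : ρ ^ (t : ℝ) = (M : ℝ)⁻¹)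
    (hstep : ∀ R, 0 < R → R ≤ r0 → ∀ x ∈ X, ∃ g : Fin M → E, (∀ i, g i ∈ X) ∧
      (∀ i, dist (g i) x ≤ R / 2) ∧ (∀ i j, i ≠ j → 4 * ρ * R ≤ dist (g i) (g j)) ∧
      (∀ i, ∀ z, dist z (g i) ≤ ρ * R → ∀ a, R * A a < η → κ * R ≤ dist z (P a))) :
    (t : ℝ≥0∞) ≤ dimH (X ∩ {z | ∃ c : ℝ, 0 < c ∧ ∀ a, c / A a ≤ dist z (P a)}) := by
  obtain ⟨x0, hx0⟩ := hne
  let r : ℕ → ℝ := fun n => r0 * ρ ^ n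
  have hrpos : ∀ n, 0 < r n := fun n => by positivity
  have hrle : ∀ n, r n ≤ r0 := fun n =>
    mul_le_of_le_one_right hr0.le (pow_le_one₀ hρ0.le (by linarith))
  have hrs : ∀ n, r (n+1) = ρ * r n := fun n => by simp only [r]; ring
  have hch := fun (n : ℕ) (x : X) => hstep (r n) (hrpos n) (hrle n) x x.2
  choose g hgX hgd hgs hgP using hch
  let p : (ℕ → Fin M) → ℕ → X := fun ω n =>
    Nat.rec (motive := fun _ => X) ⟨x0, hx0⟩ (fun n x => ⟨g n x (ω n), hgX n x (ω n)⟩) n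
  have hp : ∀ ω n, (p ω (n+1)).1 = g n (p ω n) (ω n) := fun ω n => rfl
  have hstepd : ∀ ω n, dist ((p ω n : X) : E) (p ω (n+1)) ≤ (r0 / 2) * ρ ^ n := by
    intro ω n
    rw [hp, dist_comm]
    refine (hgd n _ _).trans (le_of_eq ?_)
    simp only [r]; ring
  have hlim : ∀ ω, ∃ z, Tendsto (fun n => ((p ω n : X) : E)) atTop (nhds z) := fun ω =>
    cauchySeq_tendsto_of_complete
      (cauchySeq_of_le_geometric ρ (r0 / 2) (by linarith) (hstepd ω))
  choose G hG using hlim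
  have hGd : ∀ ω n, dist ((p ω n : X) : E) (G ω) ≤ r n := by
    intro ω n
    refine (dist_le_of_le_geometric_of_tendsto ρ (r0 / 2) (by linarith) (hstepd ω) (hG ω) n).trans ?_
    rw [div_le_iff₀ (by linarith)]
    have := hrpos n
    simp only [r] at this ⊢
    nlinarith
  have hsep : ∀ ω ω' : ℕ → Fin M, ∀ n, (∀ i < n, ω i = ω' i) → ω n ≠ ω' n →
      (2 * ρ * r0) * ρ ^ n ≤ dist (G ω) (G ω') := by
    intro ω ω' n h1 h2
    have heq : ∀ m ≤ n, p ω m = p ω' m := by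
      intro m
      induction m with
      | zero => intro _; rfl
      | succ m ih =>
        intro hm
        apply Subtype.ext
        rw [hp, hp, ih (by omega), h1 m (by omega)]
    have h3 := hgs n (p ω n) _ _ h2
    have h4 := hGd ω (n+1)
    have h5 := hGd ω' (n+1)
    rw [hp, hrs] at h4 h5
    rw [← heq n le_rfl] at h5
    have h6 := dist_triangle4 (g n (p ω n) (ω n)) (G ω) (G ω') (g n (p ω n) (ω' n))
    rw [dist_comm (G ω') (g n (p ω n) (ω' n))] at h6
    have : 2 * ρ * r0 * ρ ^ n = 2 * ρ * r n := by simp only [r]; ring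
    rw [this]
    linarith
  refine (dim_lower hM G ρ (2 * ρ * r0) t hρ0 (by positivity) ht hρ hsep).trans (dimH_mono ?_)
  rintro _ ⟨ω, rfl⟩
  refine ⟨hcl.mem_of_tendsto (hG ω) (Eventually.of_forall (fun n => (p ω n).2)), ?_⟩
  refine ⟨min (κ * r0) (κ * ρ * η), by positivity, fun a => ?_⟩
  have hApos : 0 < A a := by linarith [hA a]
  have hex : ∃ n, r n * A a < η := by
    obtain ⟨n, hn⟩ := exists_pow_lt_of_lt_one (show 0 < η / (r0 * A a) by positivity)
      (show ρ < 1 by linarith)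
    refine ⟨n, ?_⟩
    rw [lt_div_iff₀ (by positivity)] at hn
    simp only [r]
    linarith
  classical
  have hspec := Nat.find_spec hex
  have hmin := fun m => Nat.find_min hex (m := m)
  generalize Nat.find hex = n at hspec hmin
  have hk : κ * r n ≤ dist (G ω) (P a) := by
    refine hgP n (p ω n) (ω n) (G ω) ?_ a hspec
    have := hGd ω (n+1)
    rw [hp, hrs] at this
    rwa [dist_comm]
  refine le_trans ?_ hk
  rw [div_le_iff₀ hApos]
  cases n with
  | zero =>
    refine (min_le_left _ _).trans ?_
    simp only [r, pow_zero, mul_one]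
    exact le_mul_of_one_le_right (by positivity) (hA a)
  | succ n =>
    refine (min_le_right _ _).trans ?_
    have h1 := hmin n (by omega)
    push Not at h1
    rw [hrs]
    have : κ * (ρ * r n) * A a = (κ * ρ) * (r n * A a) := by ring
    rw [this]
    gcongr

lemma main_aux (d : ℕ) (hd : 1 ≤ d) (X : Set (EuclideanSpace ℝ (Fin d)))
    (hne : X.Nonempty) (hcl : IsClosed X) (h : HyperplaneDiffuse X) (t : ℝ≥0) (ht0 : 0 < t)
    (ht : (t : ℝ≥0∞) < lowerDim X) : (t : ℝ≥0∞) ≤ dimH (X ∩ badApprox d) := by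
  obtain ⟨s, hts, hs⟩ := ENNReal.lt_iff_exists_nnreal_btwn.1 ht
  have hts' : (t:ℝ) < s := by exact_mod_cast hts
  have htpos : (0:ℝ) < t := by exact_mod_cast ht0
  obtain ⟨β', hβ', hdiff'⟩ := h
  -- a smaller diffuseness constant at most one
  obtain ⟨β, hβ, hβ1, hdiff⟩ : ∃ β : ℝ, 0 < β ∧ β ≤ 1 ∧ ∀ R ∈ Set.Ioo (0:ℝ) 1, ∀ x ∈ X,
      ∀ V : Set (EuclideanSpace ℝ (Fin d)), IsAffineHyperplane V →
        ∃ y ∈ X, dist y x ≤ R ∧ ∀ v ∈ V, β * R ≤ dist y v := by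
    refine ⟨min β' 1, by positivity, min_le_right _ _, fun R hR x hx V hV => ?_⟩
    obtain ⟨y, ⟨hy1, hy2⟩, hy3⟩ := hdiff' R hR x hx V hV
    refine ⟨y, hy2, hy1, fun v hv => ?_⟩
    by_contra hcon
    push Not at hcon
    refine hy3 (mem_thickening_iff.2 ⟨v, hv, hcon.trans_le ?_⟩)
    have := hR.1
    gcongr
    exact min_le_left _ _
  -- the diameter is positive
  obtain ⟨R0, hR0pos, hR0half, hR0diam⟩ : ∃ R0 : ℝ, 0 < R0 ∧ R0 ≤ 1 / 2 ∧
      ENNReal.ofReal R0 ≤ EMetric.diam X := by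
    obtain ⟨x, hx⟩ := hne
    let φ : EuclideanSpace ℝ (Fin d) →ₗ[ℝ] ℝ :=
      { toFun := fun y => y ⟨0, hd⟩
        map_add' := by intro y z; simp
        map_smul' := by intro y z; simp }
    obtain ⟨y, hy, -, hyv⟩ := hdiff (1/2) (by constructor <;> norm_num) x hx {z | φ z = φ x}
      ⟨φ, φ x, by
        intro hz
        have : (1:ℝ) = 0 := LinearMap.congr_fun hz (WithLp.toLp 2 (fun _ => 1))
        norm_num at this, rfl⟩
    have h1 := hyv x rfl
    refine ⟨min (1/2) (dist y x), ?_, min_le_left _ _, ?_⟩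
    · have : 0 < dist y x := by linarith
      positivity
    · refine (ENNReal.ofReal_le_ofReal (min_le_right _ _)).trans ?_
      rw [← edist_dist]
      exact Metric.edist_le_ediam_of_mem hy hx
  obtain ⟨c, hc, hsep⟩ := uniform_sep X s R0
    (step_sep X hcl s hs R0 hR0diam (8 ^ (s:ℝ)) 1 one_pos)
  -- the branching number
  have hc' : 0 < c * (β / 32) ^ (s:ℝ) := by positivity
  obtain ⟨M, hM1, hM2, hM3⟩ : ∃ M : ℕ, 1 < M ∧ (M:ℝ) ^ (-(1 / (t:ℝ))) ≤ β / 16 ∧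
      1 / (c * (β / 32) ^ (s:ℝ)) ≤ (M:ℝ) ^ ((s:ℝ) / t - 1) := by
    have e1 : ∀ᶠ M : ℕ in atTop, 1 < M := eventually_gt_atTop 1
    have e2 : ∀ᶠ M : ℕ in atTop, (M:ℝ) ^ (-(1 / (t:ℝ))) < β / 16 :=
      ((tendsto_rpow_neg_atTop (show 0 < 1 / (t:ℝ) by positivity)).comp
        tendsto_natCast_atTop_atTop).eventually (gt_mem_nhds (by positivity))
    have e3 : ∀ᶠ M : ℕ in atTop, 1 / (c * (β / 32) ^ (s:ℝ)) ≤ (M:ℝ) ^ ((s:ℝ) / t - 1) :=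
      ((tendsto_rpow_atTop (show 0 < (s:ℝ) / t - 1 by
          rw [sub_pos, lt_div_iff₀ htpos]; linarith)).comp
        tendsto_natCast_atTop_atTop).eventually (eventually_ge_atTop _)
    obtain ⟨M, h1, h2, h3⟩ := (e1.and (e2.and e3)).exists
    exact ⟨M, h1, h2.le, h3⟩
  have hMpos : (0:ℝ) < M := by exact_mod_cast (by omega : 0 < M)
  set ρ : ℝ := (M:ℝ) ^ (-(1 / (t:ℝ))) with hρdef
  have hρpos : 0 < ρ := by positivity
  have hρt : ρ ^ (t:ℝ) = (M:ℝ)⁻¹ := by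
    rw [hρdef, ← Real.rpow_mul hMpos.le, ← Real.rpow_neg_one]
    congr 1
    field_simp
  have hρs : (M:ℝ) ≤ c * (β / 32 / ρ) ^ (s:ℝ) := by
    have h1 : (ρ ^ (s:ℝ))⁻¹ = M * (M:ℝ) ^ ((s:ℝ) / t - 1) := by
      rw [Real.rpow_sub_one hMpos.ne', hρdef, ← Real.rpow_mul hMpos.le, ← Real.rpow_neg hMpos.le]
      rw [mul_div_cancel₀ _ hMpos.ne']
      congr 1
      ring
    rw [Real.div_rpow (x := β / 32) (by positivity) hρpos.le, div_eq_mul_inv, h1]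
    rw [div_le_iff₀ hc'] at hM3
    nlinarith
  have hmain := tree_dim X hcl hne
    (ι := {a : (Fin d → ℤ) × ℕ // 1 ≤ a.2})
    (fun a => (WithLp.equiv 2 (Fin d → ℝ)).symm (fun k => (a.1.1 k : ℝ) / (a.1.2 : ℝ)))
    (fun a => (a.1.2 : ℝ) ^ ((1 : ℝ) + 1 / d))
    (fun a => Real.one_le_rpow (by exact_mod_cast a.2) (by positivity))
    hM1 ρ R0 (β / 16) (1 / (2 * (d+1).factorial)) t hρpos (by linarith) hR0pos (by positivity)
    (by positivity) ht0 hρt (by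
      intro R hR hRR0 x hx
      obtain ⟨V, hV, hVr⟩ := simplex_lemma hd x R hR
      obtain ⟨x', hx', hx'd, hx'V⟩ := hdiff (R / 4) ⟨by positivity, by linarith⟩ x hx V hV
      have hβR : β * R ≤ R := by nlinarith
      obtain ⟨F, hFX, hFd, hFs, hFc⟩ := hsep x' hx' (β * R / 8) (by positivity) (by linarith)
        (4 * ρ * R) (by positivity)
      have hcard : M ≤ F.card := by
        have h1 : β * R / 8 / (4 * ρ * R) = β / 32 / ρ := by
          field_simp
          norm_num
        rw [h1] at hFc
        exact_mod_cast hρs.trans hFc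
      have hg : Fintype.card (Fin M) ≤ Fintype.card F := by simpa using hcard
      obtain ⟨g⟩ := Function.Embedding.nonempty_of_card_le hg
      have hgd : ∀ i, dist (g i : EuclideanSpace ℝ (Fin d)) x ≤ β * R / 8 + R / 4 := fun i =>
        (dist_triangle _ x' _).trans (add_le_add (hFd _ (g i).2) hx'd)
      refine ⟨fun i => (g i : EuclideanSpace ℝ (Fin d)), fun i => hFX (g i).2, fun i => ?_,
        fun i j hij => ?_, fun i z hz a ha => ?_⟩
      · have := hgd i
        linarith
      · refine hFs _ (g i).2 _ (g j).2 (fun he => hij (g.injective (Subtype.ext he)))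
      · have hρR : ρ * R ≤ β * R / 16 := by nlinarith
        by_cases hnear : dist ((WithLp.equiv 2 (Fin d → ℝ)).symm
            (fun k => (a.1.1 k : ℝ) / (a.1.2 : ℝ))) x ≤ 2 * R
        · have h1 := hx'V _ (hVr a.1.1 a.1.2 a.2 ha hnear)
          have h2 := hFd _ (g i).2
          have h3 := dist_triangle4 x' (g i : EuclideanSpace ℝ (Fin d)) z
            ((WithLp.equiv 2 (Fin d → ℝ)).symm (fun k => (a.1.1 k : ℝ) / (a.1.2 : ℝ)))
          rw [dist_comm x' (g i : EuclideanSpace ℝ (Fin d)),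
            dist_comm (g i : EuclideanSpace ℝ (Fin d)) z] at h3
          have hz' : dist z (g i : EuclideanSpace ℝ (Fin d)) ≤ ρ * R := hz
          linarith
        · push Not at hnear
          have h2 := hgd i
          have h3 := dist_triangle4 ((WithLp.equiv 2 (Fin d → ℝ)).symm
            (fun k => (a.1.1 k : ℝ) / (a.1.2 : ℝ))) z (g i : EuclideanSpace ℝ (Fin d)) x
          rw [dist_comm _ z] at h3
          have hz' : dist z (g i : EuclideanSpace ℝ (Fin d)) ≤ ρ * R := hz
          linarith)
  refine hmain.trans (dimH_mono ?_)
  rintro z ⟨hzX, c, hc, hz⟩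
  refine ⟨hzX, c, hc, fun p q hq => ?_⟩
  have := hz ⟨(p, q), hq⟩
  rwa [dist_eq_norm] at this

/-- For a nonempty closed hyperplane diffuse set `X ⊆ ℝ^d`, the badly
approximable points in `X` have Hausdorff dimension at least the lower dimension of `X`. -/
theorem stmt11 (d : ℕ) (hd : 1 ≤ d) (X : Set (EuclideanSpace ℝ (Fin d)))
    (hne : X.Nonempty) (hcl : IsClosed X) (h : HyperplaneDiffuse X) :
    lowerDim X ≤ dimH (X ∩ badApprox d) := by
  refine ENNReal.le_of_forall_nnreal_lt (fun t ht => ?_)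
  rcases eq_or_lt_of_le (zero_le (a := t)) with h0 | h0
  · rw [← h0]; simp
  · exact main_aux d hd X hne hcl h t h0 ht

end
end

section
/- Let X be a parabolic Cantor set. Then dim_H(Bad₁ ∩ X) = dim_H X. -/
open Set Filter Metric
open scoped ENNReal NNReal

noncomputable section

/-- The set of badly approximable real numbers. -/
def bad1 : Set ℝ :=
  {x | ∃ c : ℝ, 0 < c ∧ ∀ (p : ℤ) (q : ℕ), 1 ≤ q → c / (q : ℝ) ^ 2 ≤ |x - (p : ℝ) / (q : ℝ)|}

/-- The data of a (possibly parabolic) IFS in a convenient form. -/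
structure PSys (Λ : Type) where
  f : Λ → ℝ → ℝ
  d : Λ → ℝ → ℝ
  C : ℝ
  C_nonneg : 0 ≤ C
  maps : ∀ i, MapsTo (f i) (Icc (0:ℝ) 1) (Icc (0:ℝ) 1)
  hd : ∀ i, ∀ x ∈ Icc (0:ℝ) 1, HasDerivWithinAt (f i) (d i x) (Icc (0:ℝ) 1) x
  dne : ∀ i, ∀ x ∈ Icc (0:ℝ) 1, d i x ≠ 0
  dle : ∀ i, ∀ x ∈ Icc (0:ℝ) 1, |d i x| ≤ 1
  dcont : ∀ i, ContinuousOn (d i) (Icc (0:ℝ) 1)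
  dlog : ∀ i, ∀ x ∈ Icc (0:ℝ) 1, ∀ y ∈ Icc (0:ℝ) 1,
    |Real.log (|d i x|) - Real.log (|d i y|)| ≤ C * |x - y|
  contr : ∀ i, ∀ x ∈ Icc (0:ℝ) 1, ∀ y ∈ Icc (0:ℝ) 1, x ≠ y → |f i x - f i y| < |x - y|
  osc1 : ∀ i, MapsTo (f i) (Ioo (0:ℝ) 1) (Ioo (0:ℝ) 1)
  osc2 : Pairwise fun i i' => Disjoint (f i '' Ioo (0:ℝ) 1) (f i' '' Ioo (0:ℝ) 1)

namespace PSys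

variable {Λ : Type} (S : PSys Λ)

/-- Composition along a word. -/
def F : List Λ → ℝ → ℝ
  | [] => fun x => x
  | a :: w => fun x => S.f a (F w x)

/-- Absolute derivative along a word. -/
def D : List Λ → ℝ → ℝ
  | [] => fun _ => 1
  | a :: w => fun x => |S.d a (S.F w x)| * D w x

/-- Sum of the lengths of images along proper suffixes of a word. -/
def E : List Λ → ℝ → ℝ → ℝ
  | [] => fun _ _ => 0
  | _ :: w => fun x y => |S.F w x - S.F w y| + E w x y

@[simp] lemma F_nil (x : ℝ) : S.F [] x = x := rfl
@[simp] lemma F_cons (a : Λ) (w : List Λ) (x : ℝ) : S.F (a :: w) x = S.f a (S.F w x) := rfl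
@[simp] lemma D_nil (x : ℝ) : S.D [] x = 1 := rfl
@[simp] lemma D_cons (a : Λ) (w : List Λ) (x : ℝ) :
    S.D (a :: w) x = |S.d a (S.F w x)| * S.D w x := rfl
@[simp] lemma E_nil (x y : ℝ) : S.E [] x y = 0 := rfl
@[simp] lemma E_cons (a : Λ) (w : List Λ) (x y : ℝ) :
    S.E (a :: w) x y = |S.F w x - S.F w y| + S.E w x y := rfl

lemma F_append (w v : List Λ) (x : ℝ) : S.F (w ++ v) x = S.F w (S.F v x) := by
  induction w with
  | nil => rfl
  | cons a w ih => simp [ih]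

lemma D_append (w v : List Λ) (x : ℝ) : S.D (w ++ v) x = S.D w (S.F v x) * S.D v x := by
  induction w with
  | nil => simp
  | cons a w ih => simp [ih, F_append, mul_assoc]

lemma E_append (w v : List Λ) (x y : ℝ) :
    S.E (w ++ v) x y = S.E w (S.F v x) (S.F v y) + S.E v x y := by
  induction w with
  | nil => simp
  | cons a w ih => simp [ih, F_append, add_assoc]

lemma F_maps (w : List Λ) : MapsTo (S.F w) (Icc (0:ℝ) 1) (Icc (0:ℝ) 1) := by
  induction w with
  | nil => intro x hx; exact hx
  | cons a w ih => intro x hx; exact S.maps a (ih hx)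

lemma F_maps_Ioo (w : List Λ) : MapsTo (S.F w) (Ioo (0:ℝ) 1) (Ioo (0:ℝ) 1) := by
  induction w with
  | nil => intro x hx; exact hx
  | cons a w ih => intro x hx; exact S.osc1 a (ih hx)

lemma D_pos (w : List Λ) {x : ℝ} (hx : x ∈ Icc (0:ℝ) 1) : 0 < S.D w x := by
  induction w with
  | nil => simp
  | cons a w ih => exact mul_pos (abs_pos.2 (S.dne a _ (S.F_maps w hx))) ih

lemma D_le_one (w : List Λ) {x : ℝ} (hx : x ∈ Icc (0:ℝ) 1) : S.D w x ≤ 1 := by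
  induction w with
  | nil => simp
  | cons a w ih =>
    exact mul_le_one₀ (S.dle a _ (S.F_maps w hx)) (S.D_pos w hx).le ih

lemma E_nonneg (w : List Λ) (x y : ℝ) : 0 ≤ S.E w x y := by
  induction w with
  | nil => simp
  | cons a w ih => simp only [E_cons]; positivity

lemma f_lip (a : Λ) {x y : ℝ} (hx : x ∈ Icc (0:ℝ) 1) (hy : y ∈ Icc (0:ℝ) 1) :
    |S.f a x - S.f a y| ≤ |x - y| := by
  by_cases h : x = y
  · simp [h]
  · exact (S.contr a x hx y hy h).le

lemma F_lip (w : List Λ) {x y : ℝ} (hx : x ∈ Icc (0:ℝ) 1) (hy : y ∈ Icc (0:ℝ) 1) :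
    |S.F w x - S.F w y| ≤ |x - y| := by
  induction w with
  | nil => simp
  | cons a w ih => exact (S.f_lip a (S.F_maps w hx) (S.F_maps w hy)).trans ih

lemma E_le_length (w : List Λ) {x y : ℝ} (hx : x ∈ Icc (0:ℝ) 1) (hy : y ∈ Icc (0:ℝ) 1) :
    S.E w x y ≤ w.length * |x - y| := by
  induction w with
  | nil => simp
  | cons a w ih =>
    have := S.F_lip w hx hy
    simp only [E_cons, List.length_cons]; push_cast; linarith

lemma F_hasDeriv (w : List Λ) {x : ℝ} (hx : x ∈ Icc (0:ℝ) 1) :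
    ∃ d', HasDerivWithinAt (S.F w) d' (Icc (0:ℝ) 1) x ∧ |d'| = S.D w x := by
  induction w with
  | nil => exact ⟨1, hasDerivWithinAt_id _ _, by simp⟩
  | cons a w ih =>
    obtain ⟨d', h1, h2⟩ := ih
    refine ⟨S.d a (S.F w x) * d', ?_, by simp [abs_mul, h2]⟩
    exact (S.hd a _ (S.F_maps w hx)).comp x h1 (S.F_maps w)

lemma F_cont (w : List Λ) : ContinuousOn (S.F w) (Icc (0:ℝ) 1) := by
  intro x hx
  obtain ⟨d', h1, _⟩ := S.F_hasDeriv w hx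
  exact h1.continuousWithinAt

lemma D_cont (w : List Λ) : ContinuousOn (S.D w) (Icc (0:ℝ) 1) := by
  induction w with
  | nil => exact continuousOn_const
  | cons a w ih =>
    exact (((S.dcont a).comp (S.F_cont w) (S.F_maps w)).abs).mul ih

lemma mvt_lt (w : List Λ) {x y : ℝ} (hx : x ∈ Icc (0:ℝ) 1) (hy : y ∈ Icc (0:ℝ) 1) (hxy : x < y) :
    ∃ ξ ∈ Ioo x y, |S.F w y - S.F w x| = S.D w ξ * |y - x| := by
  have hsub : Icc x y ⊆ Icc (0:ℝ) 1 := Icc_subset_Icc hx.1 hy.2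
  have key : ∀ z ∈ Ioo x y, ∃ d', HasDerivAt (S.F w) d' z ∧ |d'| = S.D w z := by
    intro z hz
    obtain ⟨d', h1, h2⟩ := S.F_hasDeriv w (hsub (Ioo_subset_Icc_self hz))
    refine ⟨d', h1.hasDerivAt ?_, h2⟩
    exact Icc_mem_nhds (lt_of_le_of_lt hx.1 hz.1) (lt_of_lt_of_le hz.2 hy.2)
  obtain ⟨ξ, hξ, h⟩ := exists_deriv_eq_slope (S.F w) hxy ((S.F_cont w).mono hsub) (by
    intro z hz
    obtain ⟨d', h1, _⟩ := key z hz
    exact h1.differentiableAt.differentiableWithinAt)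
  refine ⟨ξ, hξ, ?_⟩
  obtain ⟨d', h1, h2⟩ := key ξ hξ
  rw [← h2, ← h1.deriv, h, abs_div, div_mul_cancel₀]
  exact abs_ne_zero.2 (sub_ne_zero.2 hxy.ne')

lemma mvt (w : List Λ) {x y : ℝ} (hx : x ∈ Icc (0:ℝ) 1) (hy : y ∈ Icc (0:ℝ) 1) (hxy : x ≠ y) :
    ∃ ξ ∈ uIoo x y, |S.F w x - S.F w y| = S.D w ξ * |x - y| := by
  rcases lt_or_gt_of_ne hxy with h | h
  · obtain ⟨ξ, h1, h2⟩ := S.mvt_lt w hx hy h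
    refine ⟨ξ, by rwa [uIoo_of_lt h], ?_⟩
    rw [abs_sub_comm, h2, abs_sub_comm]
  · obtain ⟨ξ, h1, h2⟩ := S.mvt_lt w hy hx h
    exact ⟨ξ, by rwa [uIoo_of_gt h], h2⟩

lemma uIoo_sub {x y : ℝ} (hx : x ∈ Icc (0:ℝ) 1) (hy : y ∈ Icc (0:ℝ) 1) :
    uIoo x y ⊆ Ioo (0:ℝ) 1 := by
  intro z hz
  rw [uIoo, mem_Ioo] at hz
  exact ⟨lt_of_le_of_lt (le_inf hx.1 hy.1) hz.1, lt_of_lt_of_le hz.2 (sup_le hx.2 hy.2)⟩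

lemma log_D (w : List Λ) {x y : ℝ} (hx : x ∈ Icc (0:ℝ) 1) (hy : y ∈ Icc (0:ℝ) 1) :
    |Real.log (S.D w x) - Real.log (S.D w y)| ≤ S.C * S.E w x y := by
  induction w with
  | nil => simp
  | cons a w ih =>
    have h1 := S.dlog a _ (S.F_maps w hx) _ (S.F_maps w hy)
    rw [D_cons, D_cons, Real.log_mul (abs_ne_zero.2 (S.dne a _ (S.F_maps w hx))) (S.D_pos w hx).ne',
      Real.log_mul (abs_ne_zero.2 (S.dne a _ (S.F_maps w hy))) (S.D_pos w hy).ne', E_cons]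
    rw [abs_le] at *
    constructor <;> nlinarith

lemma D_le_exp (w : List Λ) {x y : ℝ} (hx : x ∈ Icc (0:ℝ) 1) (hy : y ∈ Icc (0:ℝ) 1) :
    S.D w x ≤ Real.exp (S.C * S.E w x y) * S.D w y := by
  have h := (abs_le.1 (S.log_D w hx hy)).2
  calc S.D w x = Real.exp (Real.log (S.D w x)) := (Real.exp_log (S.D_pos w hx)).symm
    _ ≤ Real.exp (S.C * S.E w x y + Real.log (S.D w y)) := Real.exp_le_exp.2 (by linarith)
    _ = _ := by rw [Real.exp_add, Real.exp_log (S.D_pos w hy)]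

lemma F_inj (w : List Λ) : InjOn (S.F w) (Icc (0:ℝ) 1) := by
  intro x hx y hy h
  by_contra hne
  obtain ⟨ξ, hξ, h2⟩ := S.mvt w hx hy hne
  rw [h, sub_self, abs_zero] at h2
  have := S.D_pos w (Ioo_subset_Icc_self (uIoo_sub hx hy hξ))
  have : 0 < |x - y| := abs_pos.2 (sub_ne_zero.2 hne)
  nlinarith [mul_pos ‹0 < S.D w ξ› this]

lemma F_mono (w : List Λ) :
    StrictMonoOn (S.F w) (Icc (0:ℝ) 1) ∨ StrictAntiOn (S.F w) (Icc (0:ℝ) 1) :=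
  (S.F_cont w).strictMonoOn_of_injOn_Icc' zero_le_one (S.F_inj w)

lemma uIoo_subset_image (w : List Λ) {a b : ℝ} (ha : a ∈ Icc (0:ℝ) 1) (hb : b ∈ Icc (0:ℝ) 1) :
    uIoo (S.F w a) (S.F w b) ⊆ S.F w '' uIoo a b := by
  intro y hy
  have hsub : uIcc a b ⊆ Icc (0:ℝ) 1 := uIcc_subset_Icc ha hb
  obtain ⟨t, ht, rfl⟩ := intermediate_value_uIcc ((S.F_cont w).mono hsub) (uIoo_subset_uIcc_self hy)
  refine ⟨t, ?_, rfl⟩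
  have h1 : t ≠ a := by
    rintro rfl; simp [uIoo] at hy; linarith [hy.1, hy.2]
  have h2 : t ≠ b := by
    rintro rfl; simp [uIoo] at hy; linarith [hy.1, hy.2]
  rcases mem_uIcc.1 ht with ⟨h3, h4⟩ | ⟨h3, h4⟩
  · have h5 := lt_of_le_of_ne h3 (Ne.symm h1)
    have h6 := lt_of_le_of_ne h4 h2
    rw [uIoo_of_lt (h5.trans h6)]; exact ⟨h5, h6⟩
  · have h5 := lt_of_le_of_ne h3 (Ne.symm h2)
    have h6 := lt_of_le_of_ne h4 h1
    rw [uIoo_of_gt (h5.trans h6)]; exact ⟨h5, h6⟩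

lemma zero_mem : (0:ℝ) ∈ Icc (0:ℝ) 1 := ⟨le_rfl, zero_le_one⟩
lemma one_mem : (1:ℝ) ∈ Icc (0:ℝ) 1 := ⟨zero_le_one, le_rfl⟩

lemma uIoo01 : uIoo (0:ℝ) 1 = Ioo 0 1 := uIoo_of_lt zero_lt_one

/-- points outside the open cylinder are far from points in the core -/
lemma away (w : List Λ) {c δ t y : ℝ} (hc : ∀ x ∈ Icc (0:ℝ) 1, c ≤ S.D w x)
    (hδ : 0 < δ) (ht : t ∈ Icc δ (1 - δ)) (hy : y ∉ S.F w '' Ioo 0 1) :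
    c * δ ≤ |S.F w t - y| := by
  have htI : t ∈ Ioo (0:ℝ) 1 := ⟨hδ.trans_le ht.1, by linarith [ht.2]⟩
  have htI' := Ioo_subset_Icc_self htI
  have low : ∀ z ∈ Icc (0:ℝ) 1, δ ≤ |t - z| → c * δ ≤ |S.F w t - S.F w z| := by
    intro z hz hz'
    have hne : t ≠ z := by rintro rfl; simp at hz'; linarith
    obtain ⟨ξ, hξ, h2⟩ := S.mvt w htI' hz hne
    rw [h2]
    exact mul_le_mul (hc _ (Ioo_subset_Icc_self (uIoo_sub htI' hz hξ))) hz' hδ.le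
      (S.D_pos w (Ioo_subset_Icc_self (uIoo_sub htI' hz hξ))).le
  have h0 := low 0 zero_mem (by rw [sub_zero, abs_of_pos htI.1]; exact ht.1)
  have h1 := low 1 one_mem (by rw [abs_of_neg (by linarith [htI.2])]; linarith [ht.2])
  have hy' : y ∉ uIoo (S.F w 0) (S.F w 1) := by
    intro h; apply hy; rw [← uIoo01]; exact S.uIoo_subset_image w zero_mem one_mem h
  rcases S.F_mono w with hm | hm
  · have a1 := hm zero_mem htI' htI.1
    have a2 := hm htI' one_mem htI.2
    rw [uIoo_of_lt (a1.trans a2)] at hy'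
    rw [abs_of_pos (by linarith)] at h0
    rw [abs_of_neg (by linarith)] at h1
    by_contra hcon
    rw [not_le, abs_lt] at hcon
    exact hy' ⟨by linarith [hcon.2], by linarith [hcon.1]⟩
  · have a1 := hm zero_mem htI' htI.1
    have a2 := hm htI' one_mem htI.2
    rw [uIoo_of_gt (a2.trans a1)] at hy'
    rw [abs_of_neg (by linarith)] at h0
    rw [abs_of_pos (by linarith)] at h1
    by_contra hcon
    rw [not_le, abs_lt] at hcon
    exact hy' ⟨by linarith [hcon.2], by linarith [hcon.1]⟩

lemma sum_le_one {ι : Type*} (s : Finset ι) (w : ι → List Λ) {a b : ℝ}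
    (ha : a ∈ Icc (0:ℝ) 1) (hb : b ∈ Icc (0:ℝ) 1)
    (hdisj : ∀ i ∈ s, ∀ j ∈ s, i ≠ j → Disjoint (S.F (w i) '' uIoo a b) (S.F (w j) '' uIoo a b)) :
    ∑ i ∈ s, |S.F (w i) a - S.F (w i) b| ≤ 1 := by
  have h1 : MeasureTheory.volume (⋃ i ∈ s, uIoo (S.F (w i) a) (S.F (w i) b))
      = ∑ i ∈ s, MeasureTheory.volume (uIoo (S.F (w i) a) (S.F (w i) b)) := by
    apply MeasureTheory.measure_biUnion_finset
    · intro i hi j hj hij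
      exact (hdisj i hi j hj hij).mono (S.uIoo_subset_image _ ha hb) (S.uIoo_subset_image _ ha hb)
    · intro i _; exact isOpen_Ioo.measurableSet
  have h2 : MeasureTheory.volume (⋃ i ∈ s, uIoo (S.F (w i) a) (S.F (w i) b)) ≤ 1 := by
    have : (⋃ i ∈ s, uIoo (S.F (w i) a) (S.F (w i) b)) ⊆ Ioo 0 1 := by
      apply iUnion₂_subset
      intro i _
      exact uIoo_sub (S.F_maps _ ha) (S.F_maps _ hb)
    calc _ ≤ MeasureTheory.volume (Ioo (0:ℝ) 1) := MeasureTheory.measure_mono this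
      _ = 1 := by simp
  have h3 : ∀ i ∈ s, MeasureTheory.volume (uIoo (S.F (w i) a) (S.F (w i) b))
      = ENNReal.ofReal |S.F (w i) a - S.F (w i) b| := by
    intro i _
    rw [uIoo, Real.volume_Ioo, max_sub_min_eq_abs]
    congr 1; rw [abs_sub_comm]
  rw [h1, Finset.sum_congr rfl h3, ← ENNReal.ofReal_sum_of_nonneg (fun _ _ => abs_nonneg _)] at h2
  simpa using h2

lemma side (w : List Λ) {r : ℝ} (hr : r ∈ S.F w '' Icc (0:ℝ) 1) :
    S.F w '' Ioo 0 1 ∈ nhdsWithin r (Iio r) ∨ S.F w '' Ioo 0 1 ∈ nhdsWithin r (Ioi r) := by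
  have hne : S.F w 0 ≠ S.F w 1 := fun h => zero_ne_one (S.F_inj w zero_mem one_mem h)
  have hsub := S.uIoo_subset_image w zero_mem one_mem
  rw [uIoo01] at hsub
  obtain ⟨t, ht, rfl⟩ := hr
  have hmem : S.F w t ∈ Icc (min (S.F w 0) (S.F w 1)) (max (S.F w 0) (S.F w 1)) := by
    rcases S.F_mono w with hm | hm
    · have a1 := hm.monotoneOn zero_mem ht ht.1
      have a2 := hm.monotoneOn ht one_mem ht.2
      exact ⟨(min_le_left _ _).trans a1, a2.trans (le_max_right _ _)⟩
    · have a1 := hm.antitoneOn zero_mem ht ht.1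
      have a2 := hm.antitoneOn ht one_mem ht.2
      exact ⟨(min_le_right _ _).trans a2, a1.trans (le_max_left _ _)⟩
  have hlt : min (S.F w 0) (S.F w 1) < max (S.F w 0) (S.F w 1) := min_lt_max.2 hne
  rcases lt_or_ge (S.F w t) (max (S.F w 0) (S.F w 1)) with h | h
  · right
    refine mem_of_superset (Ioo_mem_nhdsGT h) (fun z hz => hsub ?_)
    exact ⟨lt_of_le_of_lt hmem.1 hz.1, hz.2⟩
  · left
    refine mem_of_superset (Ioo_mem_nhdsLT (hlt.trans_le h)) (fun z hz => hsub ?_)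
    exact ⟨hz.1, lt_of_lt_of_le hz.2 hmem.2⟩

lemma not_disj_of_mem {l : Filter ℝ} [l.NeBot] {A B : Set ℝ} (hA : A ∈ l) (hB : B ∈ l) :
    ¬ Disjoint A B := by
  rw [Set.not_disjoint_iff_nonempty_inter]
  exact Filter.nonempty_of_mem (inter_mem hA hB)

lemma three {w₁ w₂ w₃ : List Λ} {r : ℝ} (h1 : r ∈ S.F w₁ '' Icc (0:ℝ) 1)
    (h2 : r ∈ S.F w₂ '' Icc (0:ℝ) 1) (h3 : r ∈ S.F w₃ '' Icc (0:ℝ) 1)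
    (d12 : Disjoint (S.F w₁ '' Ioo (0:ℝ) 1) (S.F w₂ '' Ioo (0:ℝ) 1))
    (d13 : Disjoint (S.F w₁ '' Ioo (0:ℝ) 1) (S.F w₃ '' Ioo (0:ℝ) 1))
    (d23 : Disjoint (S.F w₂ '' Ioo (0:ℝ) 1) (S.F w₃ '' Ioo (0:ℝ) 1)) : False := by
  rcases S.side w₁ h1 with a | a <;> rcases S.side w₂ h2 with b | b <;>
    rcases S.side w₃ h3 with c | c <;>
    first
    | exact not_disj_of_mem a b d12
    | exact not_disj_of_mem a c d13
    | exact not_disj_of_mem b c d23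

lemma prefix_of_inter {w w' : List Λ}
    (h : ¬ Disjoint (S.F w '' Ioo (0:ℝ) 1) (S.F w' '' Ioo (0:ℝ) 1)) : w <+: w' ∨ w' <+: w := by
  induction w generalizing w' with
  | nil => left; exact List.nil_prefix
  | cons a w ih =>
    cases w' with
    | nil => right; exact List.nil_prefix
    | cons b w' =>
      rw [Set.not_disjoint_iff] at h
      obtain ⟨_, ⟨x, hx, rfl⟩, ⟨y, hy, hxy⟩⟩ := h
      simp only [F_cons] at hxy
      have hab : a = b := by
        by_contra hab
        exact Set.disjoint_left.1 (S.osc2 hab) ⟨_, S.F_maps_Ioo w hx, rfl⟩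
          ⟨_, S.F_maps_Ioo w' hy, hxy⟩
      subst hab
      have h2 : S.F w' y = S.F w x := by
        have := S.F_inj [a] (S.F_maps w' (Ioo_subset_Icc_self hy))
          (S.F_maps w (Ioo_subset_Icc_self hx))
        exact this hxy
      have := @ih w' (by
        rw [Set.not_disjoint_iff]
        exact ⟨_, ⟨x, hx, rfl⟩, ⟨y, hy, h2⟩⟩)
      simpa [List.cons_prefix_cons] using this

lemma disj_of_length {w w' : List Λ} (hl : w.length = w'.length) (hne : w ≠ w') :
    Disjoint (S.F w '' Ioo (0:ℝ) 1) (S.F w' '' Ioo (0:ℝ) 1) := by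
  by_contra h
  rcases S.prefix_of_inter h with h | h
  · exact hne (h.eq_of_length hl)
  · exact hne (h.eq_of_length hl.symm).symm

/-- a closed cylinder is disjoint from an open one if the open ones are disjoint -/
lemma closed_disj {w w' : List Λ}
    (h : Disjoint (S.F w '' Ioo (0:ℝ) 1) (S.F w' '' Ioo (0:ℝ) 1)) {r : ℝ}
    (hr : r ∈ S.F w '' Icc (0:ℝ) 1) : r ∉ S.F w' '' Ioo (0:ℝ) 1 := by
  rintro ⟨t, ht, rfl⟩
  have ht' := Ioo_subset_Icc_self ht
  have hn : S.F w' '' Ioo (0:ℝ) 1 ∈ nhds (S.F w' t) := by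
    have hsub := S.uIoo_subset_image w' zero_mem one_mem
    rw [uIoo01] at hsub
    refine mem_of_superset (isOpen_Ioo.mem_nhds ?_) hsub
    rcases S.F_mono w' with hm | hm
    · have a1 := hm zero_mem ht' ht.1
      have a2 := hm ht' one_mem ht.2
      exact ⟨lt_of_le_of_lt (min_le_left _ _) a1, lt_of_lt_of_le a2 (le_max_right _ _)⟩
    · have a1 := hm zero_mem ht' ht.1
      have a2 := hm ht' one_mem ht.2
      exact ⟨lt_of_le_of_lt (min_le_right _ _) a2, lt_of_lt_of_le a1 (le_max_left _ _)⟩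
  rcases S.side w hr with a | a
  · exact not_disj_of_mem a (mem_nhdsWithin_of_mem_nhds hn) h
  · exact not_disj_of_mem a (mem_nhdsWithin_of_mem_nhds hn) h

lemma ratio [Finite Λ] {ε : ℝ} (hε : 0 < ε) : ∃ η : ℝ, 0 < η ∧ η < 1 ∧ ∀ a : Λ,
    ∀ x ∈ Icc (0:ℝ) 1, ∀ y ∈ Icc (0:ℝ) 1, ε ≤ |x - y| → |S.f a x - S.f a y| ≤ η * |x - y| := by
  have key : ∀ a : Λ, ∃ η : ℝ, η < 1 ∧
    ∀ x ∈ Icc (0:ℝ) 1, ∀ y ∈ Icc (0:ℝ) 1, ε ≤ |x - y| → |S.f a x - S.f a y| ≤ η * |x - y| := by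
    intro a
    let K : Set (ℝ × ℝ) := (Icc (0:ℝ) 1 ×ˢ Icc (0:ℝ) 1) ∩ {p | ε ≤ |p.1 - p.2|}
    have hK : IsCompact K := (isCompact_Icc.prod isCompact_Icc).inter_right
      (isClosed_le continuous_const (by fun_prop))
    have hf : ContinuousOn (S.f a) (Icc (0:ℝ) 1) := S.F_cont [a]
    have hg : ContinuousOn (fun p : ℝ × ℝ => |S.f a p.1 - S.f a p.2| / |p.1 - p.2|) K := by
      apply ContinuousOn.div
      · exact ((hf.comp continuousOn_fst (fun p hp => hp.1.1)).sub
          (hf.comp continuousOn_snd (fun p hp => hp.1.2))).abs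
      · fun_prop
      · intro p hp
        have : ε ≤ |p.1 - p.2| := hp.2
        linarith
    rcases K.eq_empty_or_nonempty with he | hne
    · refine ⟨0, zero_lt_one, ?_⟩
      intro x hx y hy h
      have : (x, y) ∈ K := ⟨⟨hx, hy⟩, h⟩
      simp [he] at this
    · obtain ⟨p, hp, hmax⟩ := hK.exists_isMaxOn hne hg
      have hp2 : ε ≤ |p.1 - p.2| := hp.2
      refine ⟨|S.f a p.1 - S.f a p.2| / |p.1 - p.2|, ?_, fun x hx y hy h => ?_⟩
      · rw [div_lt_one (by linarith)]
        exact S.contr a _ hp.1.1 _ hp.1.2 (by intro h; rw [h] at hp2; simp at hp2; linarith)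
      · have := hmax (show (x, y) ∈ K from ⟨⟨hx, hy⟩, h⟩)
        simp only [mem_setOf_eq] at this
        rwa [div_le_iff₀ (by linarith)] at this
  choose η h1 h2 using key
  obtain ⟨M, hM⟩ : ∃ M : ℝ, M < 1 ∧ ∀ a, η a ≤ M := by
    rcases isEmpty_or_nonempty Λ with h | h
    · exact ⟨0, zero_lt_one, fun a => h.elim a⟩
    · obtain ⟨a, ha⟩ := Finite.exists_max η
      exact ⟨η a, h1 a, ha⟩
  refine ⟨max M (1/2), by positivity, max_lt hM.1 (by norm_num), ?_⟩
  intro a x hx y hy h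
  refine (h2 a x hx y hy h).trans ?_
  gcongr
  exact (hM.2 a).trans (le_max_left _ _)

lemma len_small [Finite Λ] {ε : ℝ} (hε : 0 < ε) : ∃ n : ℕ, ∀ w : List Λ, n ≤ w.length →
    ∀ x ∈ Icc (0:ℝ) 1, ∀ y ∈ Icc (0:ℝ) 1, |S.F w x - S.F w y| ≤ ε := by
  obtain ⟨η, h0, h1, h⟩ := S.ratio hε
  have key : ∀ w : List Λ, ∀ x ∈ Icc (0:ℝ) 1, ∀ y ∈ Icc (0:ℝ) 1,
      |S.F w x - S.F w y| ≤ max ε (η ^ w.length) := by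
    intro w x hx y hy
    induction w with
    | nil =>
      simp only [F_nil, List.length_nil, pow_zero]
      refine le_max_of_le_right ?_
      rw [abs_le]; constructor <;> linarith [hx.1, hx.2, hy.1, hy.2]
    | cons a w ih =>
      rcases le_or_gt ε |S.F w x - S.F w y| with h' | h'
      · have := h a _ (S.F_maps w hx) _ (S.F_maps w hy) h'
        rcases le_max_iff.1 ih with h2 | h2
        · exact le_max_of_le_left ((S.f_lip a (S.F_maps w hx) (S.F_maps w hy)).trans h2)
        · refine le_max_of_le_right (this.trans ?_)
          rw [List.length_cons, pow_succ, mul_comm]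
          gcongr
      · exact le_max_of_le_left ((S.f_lip a (S.F_maps w hx) (S.F_maps w hy)).trans h'.le)
  obtain ⟨n, hn⟩ := exists_pow_lt_of_lt_one hε h1
  refine ⟨n, fun w hw x hx y hy => (key w x hx y hy).trans (max_le le_rfl ?_)⟩
  exact (pow_le_pow_of_le_one h0.le h1.le hw).trans hn.le

/-- distortion of concatenations -/
lemma E_concat {z g : List Λ} {A L ρ : ℝ} (hA : L + A * ρ ≤ A) (hA0 : 0 ≤ A)
    (hz : ∀ x ∈ Icc (0:ℝ) 1, ∀ y ∈ Icc (0:ℝ) 1, S.E z x y ≤ A * |x - y|)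
    (hg : ∀ x ∈ Icc (0:ℝ) 1, ∀ y ∈ Icc (0:ℝ) 1, S.E g x y ≤ L * |x - y|)
    (hD : ∀ x ∈ Icc (0:ℝ) 1, S.D g x ≤ ρ) :
    ∀ x ∈ Icc (0:ℝ) 1, ∀ y ∈ Icc (0:ℝ) 1, S.E (z ++ g) x y ≤ A * |x - y| := by
  intro x hx y hy
  rw [E_append]
  have h1 := hz _ (S.F_maps g hx) _ (S.F_maps g hy)
  have h2 := hg x hx y hy
  have h3 : |S.F g x - S.F g y| ≤ ρ * |x - y| := by
    by_cases h : x = y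
    · simp [h]
    obtain ⟨ξ, hξ, h4⟩ := S.mvt g hx hy h
    rw [h4]
    gcongr
    exact hD _ (Ioo_subset_Icc_self (uIoo_sub hx hy hξ))
  nlinarith [abs_nonneg (x - y), mul_le_mul_of_nonneg_left h3 hA0]

end PSys


namespace PSys
variable {Λ : Type} (S : PSys Λ)

lemma disj_append (z : List Λ) {w w' : List Λ}
    (h : Disjoint (S.F w '' Ioo (0:ℝ) 1) (S.F w' '' Ioo (0:ℝ) 1)) :
    Disjoint (S.F (z ++ w) '' Ioo (0:ℝ) 1) (S.F (z ++ w') '' Ioo (0:ℝ) 1) := by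
  rw [Set.disjoint_left] at h ⊢
  rintro _ ⟨x, hx, rfl⟩ ⟨y, hy, hxy⟩
  rw [F_append, F_append] at hxy
  have := S.F_inj z (S.F_maps w' (Ioo_subset_Icc_self hy)) (S.F_maps w (Ioo_subset_Icc_self hx)) hxy
  exact h ⟨x, hx, rfl⟩ ⟨y, hy, this⟩

lemma rat_unique {p p' : ℤ} {q q' : ℕ} (hq : 1 ≤ q) (hq' : 1 ≤ q') {l : ℝ}
    (h1 : (q:ℝ) ^ 2 * l ≤ 1 / 2) (h2 : (q':ℝ) ^ 2 * l ≤ 1 / 2)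
    (h : |(p:ℝ) / q - (p':ℝ) / q'| ≤ l) : (p:ℝ) / q = (p':ℝ) / q' := by
  have hq0 : (1:ℝ) ≤ q := by exact_mod_cast hq
  have hq0' : (1:ℝ) ≤ q' := by exact_mod_cast hq'
  have hl : 0 ≤ l := (abs_nonneg _).trans h
  by_contra hne
  have hdet_ne : p * q' - p' * q ≠ 0 := by
    intro h0
    apply hne
    rw [div_eq_div_iff (by positivity) (by positivity)]
    have : ((p * q' - p' * q : ℤ) : ℝ) = 0 := by rw [h0]; simp
    push_cast at this
    linarith
  have h3 : (1:ℝ) ≤ |((p * q' - p' * q : ℤ) : ℝ)| := by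
    rw [← Int.cast_abs]; exact_mod_cast Int.one_le_abs hdet_ne
  have h4 : (p:ℝ) / q - (p':ℝ) / q' = ((p * q' - p' * q : ℤ) : ℝ) / (q * q') := by
    push_cast
    field_simp
  rw [h4, abs_div, abs_of_pos (show (0:ℝ) < q * q' by positivity), div_le_iff₀ (by positivity)] at h
  nlinarith [sq_nonneg ((q:ℝ) - q'), mul_nonneg hl (sq_nonneg ((q:ℝ) - q'))]

lemma choice_exists {W : Finset (List Λ)} {N : ℕ} (hN : N + 2 ≤ W.card)
    (hdis : ∀ w ∈ W, ∀ w' ∈ W, w ≠ w' →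
      Disjoint (S.F w '' Ioo (0:ℝ) 1) (S.F w' '' Ioo (0:ℝ) 1)) (z : List Λ) :
    ∃ c : Fin N → List Λ, Function.Injective c ∧ (∀ i, c i ∈ W) ∧
      ∀ i, ∀ (p : ℤ) (q : ℕ), 1 ≤ q → (q:ℝ) ^ 2 * |S.F z 0 - S.F z 1| ≤ 1 / 2 →
        ((p:ℝ) / q) ∉ S.F (z ++ c i) '' Icc (0:ℝ) 1 := by
  classical
  let P : List Λ → Prop := fun w => ∃ (p : ℤ) (q : ℕ), 1 ≤ q ∧
    (q:ℝ) ^ 2 * |S.F z 0 - S.F z 1| ≤ 1 / 2 ∧ ((p:ℝ) / q) ∈ S.F (z ++ w) '' Icc (0:ℝ) 1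
  have hdiam : ∀ x ∈ Icc (0:ℝ) 1, ∀ y ∈ Icc (0:ℝ) 1, |S.F z x - S.F z y| ≤ |S.F z 0 - S.F z 1| := by
    intro x hx y hy
    rcases S.F_mono z with hm | hm
    · have a1 := hm.monotoneOn zero_mem hx hx.1
      have a2 := hm.monotoneOn hx one_mem hx.2
      have a3 := hm.monotoneOn zero_mem hy hy.1
      have a4 := hm.monotoneOn hy one_mem hy.2
      rw [abs_sub_comm (S.F z 0), abs_le, abs_of_nonneg (by linarith)]
      constructor <;> linarith
    · have a1 := hm.antitoneOn zero_mem hx hx.1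
      have a2 := hm.antitoneOn hx one_mem hx.2
      have a3 := hm.antitoneOn zero_mem hy hy.1
      have a4 := hm.antitoneOn hy one_mem hy.2
      rw [abs_le, abs_of_nonneg (by linarith)]
      constructor <;> linarith
  have hP : ∀ w w', P w → P w' → ∃ r, r ∈ S.F (z ++ w) '' Icc (0:ℝ) 1 ∧
      ∀ w'', P w'' → r ∈ S.F (z ++ w'') '' Icc (0:ℝ) 1 := by
    rintro w w' ⟨p, q, hq, h1, h2⟩ _
    refine ⟨_, h2, ?_⟩
    rintro w'' ⟨p', q', hq', h1', h2'⟩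
    have : (p:ℝ) / q = (p':ℝ) / q' := by
      apply rat_unique hq hq' h1 h1'
      obtain ⟨x, hx, e⟩ := h2
      obtain ⟨y, hy, e'⟩ := h2'
      rw [← e, ← e', F_append, F_append]
      exact hdiam _ (S.F_maps _ hx) _ (S.F_maps _ hy)
    rw [this]; exact h2'
  have hcard : (W.filter P).card ≤ 2 := by
    by_contra hcon
    rw [not_le, Finset.two_lt_card] at hcon
    obtain ⟨a, ha, b, hb, c, hc, hab, hac, hbc⟩ := hcon
    rw [Finset.mem_filter] at ha hb hc
    obtain ⟨r, hr, hall⟩ := hP a b ha.2 hb.2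
    exact S.three hr (hall b hb.2) (hall c hc.2)
      (S.disj_append z (hdis a ha.1 b hb.1 hab)) (S.disj_append z (hdis a ha.1 c hc.1 hac))
      (S.disj_append z (hdis b hb.1 c hc.1 hbc))
  have hcard2 : N ≤ (W.filter (fun w => ¬ P w)).card := by
    have := Finset.card_filter_add_card_filter_not (s := W) P
    omega
  let e := (W.filter (fun w => ¬ P w)).equivFin
  refine ⟨fun i => (e.symm (Fin.castLE hcard2 i) : List Λ), ?_, ?_, ?_⟩
  · intro i j hij
    have := e.symm.injective (Subtype.ext hij)
    exact Fin.castLE_injective hcard2 this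
  · intro i
    exact (Finset.mem_filter.1 (e.symm (Fin.castLE hcard2 i)).2).1
  · intro i p q hq h1 h2
    exact (Finset.mem_filter.1 (e.symm (Fin.castLE hcard2 i)).2).2 ⟨p, q, hq, h1, h2⟩

/-- The nodes of the tree. -/
def node {N : ℕ} (ch : List Λ → Fin N → List Λ) (v : List Λ) (a : ℕ → Fin N) : ℕ → List Λ
  | 0 => []
  | n + 1 => node ch v a n ++ (ch (node ch v a n) (a n) ++ v)

lemma node_congr {N : ℕ} (ch : List Λ → Fin N → List Λ) (v : List Λ) (a b : ℕ → Fin N) (n : ℕ)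
    (h : ∀ k < n, a k = b k) : node ch v a n = node ch v b n := by
  induction n with
  | zero => rfl
  | succ n ih =>
    have := ih (fun k hk => h k (by omega))
    simp only [node, this, h n (by omega)]

lemma F_mapsX {X : Set ℝ} (hX : ∀ a, MapsTo (S.f a) X X) (w : List Λ) : MapsTo (S.F w) X X := by
  induction w with
  | nil => intro x hx; exact hx
  | cons a w ih => intro x hx; exact hX a (ih hx)

lemma holder_dim {N : ℕ} (hN : 1 < N) (pt : (ℕ → Fin N) → ℝ) {s : ℝ≥0} (hs : 0 < s) {c κ : ℝ}
    (hc : 0 < c) (hκ : 0 < κ) (hNs : 1 ≤ N * κ ^ (s:ℝ))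
    (hsep : ∀ a b n, (∀ k < n, a k = b k) → a n ≠ b n → c * κ ^ n ≤ |pt a - pt b|) :
    (s : ℝ≥0∞) ≤ dimH (range pt) := by
  have hinj : Function.Injective pt := by
    intro a b hab
    by_contra hne
    have hex : ∃ n, a n ≠ b n := Function.ne_iff.1 hne
    classical
    have := hsep a b (Nat.find hex) (fun k hk => by simpa using Nat.find_min hex hk)
      (Nat.find_spec hex)
    rw [hab, sub_self, abs_zero] at this
    have : 0 < c * κ ^ (Nat.find hex) := by positivity
    linarith
  haveI : Nonempty (ℕ → Fin N) := ⟨fun _ => ⟨0, by omega⟩⟩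
  let g : ℝ → ℝ := fun x => Real.ofDigits (Function.invFun pt x)
  have hg : ∀ a, g (pt a) = Real.ofDigits a := fun a => by
    simp only [g, Function.leftInverse_invFun hinj a]
  have hreal : ∀ a b, |g (pt a) - g (pt b)| ≤ (c⁻¹) ^ (s:ℝ) * |pt a - pt b| ^ (s:ℝ) := by
    intro a b
    rw [hg, hg]
    by_cases hab : a = b
    · subst hab; simp; positivity
    classical
    have hex : ∃ n, a n ≠ b n := Function.ne_iff.1 hab
    set n := Nat.find hex with hn
    have hag : ∀ k < n, a k = b k := fun k hk => by simpa using Nat.find_min hex hk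
    have h1 := hsep a b n hag (Nat.find_spec hex)
    have h2 : |Real.ofDigits a - Real.ofDigits b| ≤ ((N:ℝ) ^ n)⁻¹ :=
      Real.abs_ofDigits_sub_ofDigits_le hag
    have h3 : ((N:ℝ) ^ n)⁻¹ ≤ (κ ^ n) ^ (s:ℝ) := by
      rw [← inv_pow, ← Real.rpow_natCast κ n, ← Real.rpow_mul hκ.le, mul_comm (n:ℝ),
        Real.rpow_mul hκ.le, Real.rpow_natCast]
      gcongr
      rw [inv_le_iff_one_le_mul₀ (by positivity)]
      linarith
    have h4 : κ ^ n ≤ c⁻¹ * |pt a - pt b| := by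
      rw [← div_eq_inv_mul, le_div_iff₀ hc]; linarith
    calc _ ≤ _ := h2
      _ ≤ _ := h3
      _ ≤ (c⁻¹ * |pt a - pt b|) ^ (s:ℝ) := by gcongr
      _ = _ := Real.mul_rpow (by positivity) (by positivity)
  have hC0 : 0 ≤ (c⁻¹) ^ (s:ℝ) := by positivity
  have hhol : HolderOnWith (Real.toNNReal ((c⁻¹) ^ (s:ℝ))) s g (range pt) := by
    rintro _ ⟨a, rfl⟩ _ ⟨b, rfl⟩
    have := hreal a b
    rw [edist_dist, edist_dist, Real.dist_eq, Real.dist_eq,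
      ENNReal.ofReal_rpow_of_nonneg (abs_nonneg _) s.coe_nonneg]
    refine (ENNReal.ofReal_le_ofReal this).trans ?_
    rw [ENNReal.ofReal_mul hC0]
    rfl
  have h1 := hhol.dimH_image_le hs
  have h2 : Icc (0:ℝ) 1 ⊆ g '' range pt := by
    intro y hy
    obtain ⟨a, _, ha⟩ := Real.ofDigits_SurjOn hN hy
    exact ⟨pt a, ⟨a, rfl⟩, by rw [hg, ha]⟩
  have h3 : dimH (Icc (0:ℝ) 1) = 1 := by
    rw [Real.dimH_of_nonempty_interior (by simp [interior_Icc])]; simp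
  have h4 : 1 ≤ dimH (range pt) / s := by
    rw [← h3]; exact (dimH_mono h2).trans h1
  rw [ENNReal.le_div_iff_mul_le (Or.inl (by simpa using hs.ne')) (Or.inl (by simp))] at h4
  simpa using h4

theorem bad_dim {X : Set ℝ} (hXne : X.Nonempty) (hXc : IsCompact X)
    (hXsub : X ⊆ Icc 0 1) (hX : ∀ a, MapsTo (S.f a) X X) {v : List Λ} {δ κ κv : ℝ}
    (hδ : 0 < δ) (hv : ∀ x ∈ Icc (0:ℝ) 1, S.F v x ∈ Icc δ (1 - δ)) (hκv : 0 < κv)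
    (hDv : ∀ x ∈ Icc (0:ℝ) 1, κv ≤ S.D v x) (hκ : 0 < κ) {W : Finset (List Λ)}
    (hW : ∀ w ∈ W, ∀ x ∈ Icc (0:ℝ) 1, κ ≤ S.D w x ∧ S.D w x ≤ 1 / 2)
    (hdis : ∀ w ∈ W, ∀ w' ∈ W, w ≠ w' →
      Disjoint (S.F w '' Ioo (0:ℝ) 1) (S.F w' '' Ioo (0:ℝ) 1))
    {N : ℕ} (hN1 : 1 < N) (hN : N + 2 ≤ W.card) {s : ℝ≥0} (hs : 0 < s)
    (hNs : 1 ≤ N * (κ * κv) ^ (s:ℝ)) :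
    (s : ℝ≥0∞) ≤ dimH (bad1 ∩ X) := by
  choose ch hinj hmem hrat using S.choice_exists hN hdis
  set L : ℝ := ((W.sup List.length + v.length : ℕ) : ℝ) with hL
  have hL0 : 0 ≤ L := by positivity
  set B : ℝ := Real.exp (S.C * (2 * L)) with hB
  have hB0 : 0 < B := Real.exp_pos _
  set nd := node ch v with hnd
  have hg : ∀ w ∈ W, (∀ x ∈ Icc (0:ℝ) 1, S.D (w ++ v) x ≤ 1 / 2 ∧ κ * κv ≤ S.D (w ++ v) x) ∧
      ∀ x ∈ Icc (0:ℝ) 1, ∀ y ∈ Icc (0:ℝ) 1, S.E (w ++ v) x y ≤ L * |x - y| := by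
    intro w hw
    refine ⟨fun x hx => ?_, fun x hx y hy => ?_⟩
    · rw [D_append]
      have h1 := hW w hw _ (S.F_maps v hx)
      have h2 := S.D_le_one v hx
      have h3 := hDv x hx
      constructor
      · nlinarith
      · exact mul_le_mul h1.1 h3 hκv.le (by linarith)
    · refine (S.E_le_length _ hx hy).trans ?_
      gcongr
      rw [hL, List.length_append]
      exact_mod_cast Nat.add_le_add_right (Finset.le_sup (f := List.length) hw) _
  have hE : ∀ a n, ∀ x ∈ Icc (0:ℝ) 1, ∀ y ∈ Icc (0:ℝ) 1, S.E (nd a n) x y ≤ (2 * L) * |x - y| := by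
    intro a n
    induction n with
    | zero => intro x _ y _; simp only [hnd, node, E_nil]; positivity
    | succ n ih =>
      have := hg _ (hmem (nd a n) (a n))
      exact S.E_concat (by linarith) (by linarith) ih this.2 (fun x hx => (this.1 x hx).1)
  have hdist : ∀ a n, ∀ x ∈ Icc (0:ℝ) 1, ∀ y ∈ Icc (0:ℝ) 1, S.D (nd a n) x ≤ B * S.D (nd a n) y := by
    intro a n x hx y hy
    refine (S.D_le_exp _ hx hy).trans ?_
    have := (S.D_pos (nd a n) hy).le
    gcongr
    have h1 := hE a n x hx y hy
    have h2 : |x - y| ≤ 1 := by rw [abs_le]; constructor <;> linarith [hx.1, hx.2, hy.1, hy.2]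
    refine Real.exp_le_exp.2 (mul_le_mul_of_nonneg_left (h1.trans ?_) S.C_nonneg)
    nlinarith
  have hlow : ∀ a n, ∀ x ∈ Icc (0:ℝ) 1, (κ * κv) ^ n ≤ S.D (nd a n) x ∧
      S.D (nd a n) x ≤ (1 / 2) ^ n := by
    intro a n
    induction n with
    | zero => intro x _; simp [hnd, node]
    | succ n ih =>
      intro x hx
      have h1 := (hg _ (hmem (nd a n) (a n))).1 x hx
      have h2 := ih _ (S.F_maps (ch (nd a n) (a n) ++ v) hx)
      have e : nd a (n+1) = nd a n ++ (ch (nd a n) (a n) ++ v) := rfl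
      rw [e, D_append, pow_succ, pow_succ]
      have := S.D_pos (ch (nd a n) (a n) ++ v) hx
      have hkk : 0 < κ * κv := mul_pos hκ hκv
      exact ⟨mul_le_mul h2.1 h1.2 (by positivity) (le_trans (by positivity) h2.1),
        mul_le_mul h2.2 h1.1 this.le (by positivity)⟩
  -- lengths
  set ℓ : (ℕ → Fin N) → ℕ → ℝ := fun a n => |S.F (nd a n) 0 - S.F (nd a n) 1| with hℓ
  have hℓD : ∀ a n, ∃ ξ ∈ Icc (0:ℝ) 1, ℓ a n = S.D (nd a n) ξ := by
    intro a n
    obtain ⟨ξ, h1, h2⟩ := S.mvt (nd a n) zero_mem one_mem zero_ne_one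
    exact ⟨ξ, Ioo_subset_Icc_self (uIoo_sub zero_mem one_mem h1), by simpa [hℓ] using h2⟩
  -- points
  have hpt : ∀ a : ℕ → Fin N, ∃ x, ∀ n, x ∈ S.F (nd a n) '' X := by
    intro a
    have := IsCompact.nonempty_iInter_of_sequence_nonempty_isCompact_isClosed
      (fun n => S.F (nd a n) '' X) ?_ ?_ ?_ ?_
    · obtain ⟨x, hx⟩ := this
      exact ⟨x, fun n => mem_iInter.1 hx n⟩
    · rintro n _ ⟨x, hx, rfl⟩
      have e : nd a (n+1) = nd a n ++ (ch (nd a n) (a n) ++ v) := rfl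
      rw [e, F_append]
      exact ⟨_, S.F_mapsX hX _ hx, rfl⟩
    · intro n; exact hXne.image _
    · exact hXc.image_of_continuousOn ((S.F_cont _).mono hXsub)
    · intro n; exact (hXc.image_of_continuousOn ((S.F_cont _).mono hXsub)).isClosed
  choose pt hpt using hpt
  have hcore : ∀ a n, ∃ t ∈ Icc δ (1 - δ), pt a = S.F (nd a n ++ ch (nd a n) (a n)) t := by
    intro a n
    obtain ⟨x, hx, e⟩ := hpt a (n + 1)
    have e' : nd a (n+1) = nd a n ++ (ch (nd a n) (a n) ++ v) := rfl
    rw [e', ← List.append_assoc, F_append] at e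
    exact ⟨_, hv x (hXsub hx), e.symm⟩
  have hDzw : ∀ a n c, (∀ x ∈ Icc (0:ℝ) 1, c ≤ S.D (nd a n) x) → 0 ≤ c →
      ∀ x ∈ Icc (0:ℝ) 1, c * κ ≤ S.D (nd a n ++ ch (nd a n) (a n)) x := by
    intro a n c hc hc0 x hx
    rw [D_append]
    have h1 := (hW _ (hmem (nd a n) (a n)) x hx).1
    have h2 := hc _ (S.F_maps (ch (nd a n) (a n)) hx)
    exact mul_le_mul h2 h1 hκ.le (hc0.trans h2)
  have hsep : ∀ a b n, (∀ k < n, a k = b k) → a n ≠ b n →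
      (κ * δ) * (κ * κv) ^ n ≤ |pt a - pt b| := by
    intro a b n hk hne
    have hz : nd a n = nd b n := node_congr ch v a b n hk
    obtain ⟨t, ht, e⟩ := hcore a n
    obtain ⟨t', ht', e'⟩ := hcore b n
    have hne' : ch (nd b n) (b n) ≠ ch (nd a n) (a n) := by
      rw [hz]; intro h; exact hne (hinj _ h).symm
    have hd := S.disj_append (nd a n) (hdis _ (hmem (nd b n) (b n)) _ (hmem (nd a n) (a n)) hne')
    have hy : pt b ∉ S.F (nd a n ++ ch (nd a n) (a n)) '' Ioo 0 1 := by
      apply S.closed_disj hd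
      rw [e', ← hz]
      exact ⟨t', ⟨by linarith [ht'.1], by linarith [ht'.2]⟩, rfl⟩
    have := S.away _ (hDzw a n _ (fun x hx => (hlow a n x hx).1) (by positivity)) hδ ht hy
    rw [← e] at this
    linarith
  have hbad : ∀ a, pt a ∈ bad1 := by
    intro a
    refine ⟨B⁻¹ * (B⁻¹ * κ * κv * (1 / 2)) * κ * δ, by positivity, ?_⟩
    intro p q hq
    have hq0 : (1:ℝ) ≤ q := by exact_mod_cast hq
    classical
    have hex : ∃ n, (q:ℝ) ^ 2 * ℓ a n ≤ 1 / 2 := by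
      obtain ⟨n, hn⟩ := exists_pow_lt_of_lt_one (show 0 < 1 / 2 / (q:ℝ) ^ 2 by positivity)
        (show (1 / 2 : ℝ) < 1 by norm_num)
      refine ⟨n, ?_⟩
      obtain ⟨ξ, hξ, e⟩ := hℓD a n
      rw [e]
      have := (hlow a n ξ hξ).2.trans hn.le
      rw [le_div_iff₀ (by positivity)] at this
      linarith
    have hspec := Nat.find_spec hex
    have hmin := fun k hk => Nat.find_min hex (m := k) hk
    set n := Nat.find hex
    obtain ⟨m, hm⟩ : ∃ m, n = m + 1 := by
      apply Nat.exists_eq_succ_of_ne_zero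
      intro h0
      rw [h0] at hspec
      have : ℓ a 0 = 1 := by simp [hℓ, hnd, node]
      rw [this] at hspec
      nlinarith
    have h1 := hmin m (by omega)
    rw [not_le] at h1
    have hy : ((p:ℝ) / q) ∉ S.F (nd a n ++ ch (nd a n) (a n)) '' Ioo 0 1 := fun h =>
      hrat (nd a n) (a n) p q hq hspec (image_mono Ioo_subset_Icc_self h)
    obtain ⟨t, ht, e⟩ := hcore a n
    obtain ⟨ξ, hξ, eξ⟩ := hℓD a n
    obtain ⟨ξ', hξ', eξ'⟩ := hℓD a m
    have h2 : ∀ x ∈ Icc (0:ℝ) 1, B⁻¹ * ℓ a n ≤ S.D (nd a n) x := by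
      intro x hx
      rw [eξ, inv_mul_le_iff₀ hB0]
      exact hdist a n ξ hξ x hx
    have hℓn0 : 0 < ℓ a n := by rw [eξ]; exact S.D_pos _ hξ
    have h3 := S.away _ (hDzw a n _ h2 (by positivity)) hδ ht hy
    rw [← e] at h3
    have h4 : B⁻¹ * κ * κv * ℓ a m ≤ ℓ a n := by
      rw [eξ, hm]
      have e' : nd a (m+1) = nd a m ++ (ch (nd a m) (a m) ++ v) := rfl
      rw [e', D_append]
      have h5 := ((hg _ (hmem (nd a m) (a m))).1 ξ hξ).2
      have h6 := hdist a m ξ' hξ' _ (S.F_maps (ch (nd a m) (a m) ++ v) hξ)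
      rw [← eξ', ← inv_mul_le_iff₀ hB0] at h6
      have hm0 : 0 < ℓ a m := by rw [eξ']; exact S.D_pos _ hξ'
      calc B⁻¹ * κ * κv * ℓ a m = (B⁻¹ * ℓ a m) * (κ * κv) := by ring
        _ ≤ _ := mul_le_mul h6 h5 (by positivity) (le_trans (by positivity) h6)
    refine le_trans ?_ h3
    rw [div_le_iff₀ (by positivity)]
    have h7 : B⁻¹ * κ * κv * (1 / 2) ≤ ℓ a n * q ^ 2 := by
      have : B⁻¹ * κ * κv * (1 / 2) ≤ B⁻¹ * κ * κv * ((q:ℝ)^2 * ℓ a m) := by gcongr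
      nlinarith [sq_nonneg (q:ℝ)]
    calc B⁻¹ * (B⁻¹ * κ * κv * (1 / 2)) * κ * δ ≤ B⁻¹ * (ℓ a n * q ^ 2) * κ * δ := by gcongr
      _ = _ := by ring
  have hsub : range pt ⊆ bad1 ∩ X := by
    rintro _ ⟨a, rfl⟩
    refine ⟨hbad a, ?_⟩
    obtain ⟨x, hx, e⟩ := hpt a 0
    rw [← e]; exact hx
  exact (holder_dim hN1 pt hs (by positivity) (by positivity) hNs hsep).trans (dimH_mono hsub)

end PSys

namespace PSys
variable {Λ : Type} (S : PSys Λ)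

/-- The word read along `ω` from time `t`. -/
def seg (ω : ℕ → Λ) : ℕ → ℕ → List Λ
  | _, 0 => []
  | t, n + 1 => ω t :: seg ω (t + 1) n

/-- prepend a word -/
def app : List Λ → (ℕ → Λ) → (ℕ → Λ)
  | [], τ => τ
  | a :: w, τ => fun n => Nat.casesOn n a (app w τ)

/-- shift -/
def shf (k : ℕ) (τ : ℕ → Λ) : ℕ → Λ := fun n => τ (k + n)

@[simp] lemma seg_zero (ω : ℕ → Λ) (t : ℕ) : seg ω t 0 = [] := rfl
@[simp] lemma seg_succ (ω : ℕ → Λ) (t n : ℕ) : seg ω t (n + 1) = ω t :: seg ω (t + 1) n := rfl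
@[simp] lemma app_nil (τ : ℕ → Λ) : app [] τ = τ := rfl
@[simp] lemma app_cons_zero (a : Λ) (w) (τ : ℕ → Λ) : app (a :: w) τ 0 = a := rfl
@[simp] lemma app_cons_succ (a : Λ) (w) (τ : ℕ → Λ) (n : ℕ) :
    app (a :: w) τ (n + 1) = app w τ n := rfl

@[simp] lemma seg_length (ω : ℕ → Λ) (t n : ℕ) : (seg ω t n).length = n := by
  induction n generalizing t with
  | zero => rfl
  | succ n ih => simp [ih]

lemma seg_add (ω : ℕ → Λ) (t m n : ℕ) : seg ω t (m + n) = seg ω t m ++ seg ω (t + m) n := by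
  induction m generalizing t with
  | zero => simp
  | succ m ih =>
    rw [show m + 1 + n = (m + n) + 1 by ring, seg_succ, ih, seg_succ, List.cons_append]
    congr 3; ring

lemma seg_eq_iff (ω τ : ℕ → Λ) (t s n : ℕ) :
    seg ω t n = seg τ s n ↔ ∀ k < n, ω (t + k) = τ (s + k) := by
  induction n generalizing t s with
  | zero => simp
  | succ n ih =>
    rw [seg_succ, seg_succ, List.cons.injEq, ih]
    constructor
    · rintro ⟨h0, h⟩ k hk
      cases k with
      | zero => simpa using h0
      | succ k =>
        have := h k (by omega)
        rwa [show t + (k + 1) = t + 1 + k by ring, show s + (k + 1) = s + 1 + k by ring]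
    · intro h
      refine ⟨by simpa using h 0 (by omega), fun k hk => ?_⟩
      have := h (k + 1) (by omega)
      rwa [show t + (k + 1) = t + 1 + k by ring, show s + (k + 1) = s + 1 + k by ring] at this

lemma seg_shf (ω : ℕ → Λ) (k t n : ℕ) : seg (shf k ω) t n = seg ω (k + t) n := by
  rw [seg_eq_iff]; intro j _; simp [shf, add_assoc]

lemma app_add (w : List Λ) (τ : ℕ → Λ) (k : ℕ) : app w τ (w.length + k) = τ k := by
  induction w with
  | nil => simp
  | cons a w ih =>
    rw [List.length_cons, show w.length + 1 + k = (w.length + k) + 1 by ring, app_cons_succ, ih]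

lemma shf_app (w : List Λ) (τ : ℕ → Λ) : shf w.length (app w τ) = τ := by
  funext k; exact app_add w τ k

lemma shf_shf (m n : ℕ) (τ : ℕ → Λ) : shf m (shf n τ) = shf (n + m) τ := by
  funext k; simp [shf, add_assoc]

lemma app_append (w v : List Λ) (τ : ℕ → Λ) : app (w ++ v) τ = app w (app v τ) := by
  induction w with
  | nil => rfl
  | cons a w ih =>
    funext n
    cases n with
    | zero => rfl
    | succ n => simp [ih]

lemma app_seg_shf (τ : ℕ → Λ) (n : ℕ) : app (seg τ 0 n) (shf n τ) = τ := by
  have key : ∀ n t, app (seg τ t n) (shf (t + n) τ) = shf t τ := by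
    intro n
    induction n with
    | zero => intro t; simp
    | succ n ih =>
      intro t
      funext k
      cases k with
      | zero => simp [shf]
      | succ k =>
        have := congrFun (ih (t + 1)) k
        rw [seg_succ, app_cons_succ, show t + (n + 1) = t + 1 + n by ring, this]
        simp only [shf]; congr 1; ring
  have := key n 0
  rw [zero_add] at this
  rw [this]
  funext k
  simp [shf]

lemma seg_app (w : List Λ) (τ : ℕ → Λ) : seg (app w τ) 0 w.length = w := by
  induction w with
  | nil => rfl
  | cons a w ih =>
    rw [List.length_cons, seg_succ, app_cons_zero]
    congr 1
    conv_rhs => rw [← ih]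
    rw [seg_eq_iff]
    intro k _
    rw [show 0 + 1 + k = k + 1 by ring, app_cons_succ, zero_add]

/-- The Koenig lemma. -/
lemma konig [Finite Λ] (Q : ℕ → ℕ → Λ) :
    ∃ τ : ℕ → Λ, ∀ n, ∃ᶠ k in atTop, ∀ j < n, Q k j = τ j := by
  let _ : TopologicalSpace Λ := ⊥
  have : DiscreteTopology Λ := ⟨rfl⟩
  obtain ⟨τ, hτ⟩ := exists_clusterPt_of_compactSpace (Filter.map Q atTop)
  refine ⟨τ, fun n => ?_⟩
  have hτ' : MapClusterPt τ atTop Q := hτ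
  rw [mapClusterPt_iff_frequently] at hτ'
  refine hτ' {σ | ∀ j < n, σ j = τ j} ?_
  have : {σ : ℕ → Λ | ∀ j < n, σ j = τ j} = ⋂ j ∈ Finset.range n, (fun σ => σ j) ⁻¹' {τ j} := by
    ext σ; simp
  rw [this]
  refine (Filter.biInter_finset_mem _).2 fun j _ => ?_
  exact (continuous_apply j).continuousAt.preimage_mem_nhds (by simp)

/-- `x` is coded by `τ` -/
def Cod (τ : ℕ → Λ) (x : ℝ) : Prop := ∀ n, x ∈ S.F (seg τ 0 n) '' Icc (0:ℝ) 1

lemma cod_mem {τ : ℕ → Λ} {x : ℝ} (h : S.Cod τ x) : x ∈ Icc (0:ℝ) 1 := by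
  obtain ⟨y, hy, rfl⟩ := h 0
  exact hy

lemma cod_exists (τ : ℕ → Λ) : ∃ x, S.Cod τ x := by
  have h := IsCompact.nonempty_iInter_of_sequence_nonempty_isCompact_isClosed
    (fun n => S.F (seg τ 0 n) '' Icc (0:ℝ) 1) ?_ ?_ ?_ ?_
  · obtain ⟨x, hx⟩ := h
    exact ⟨x, fun n => mem_iInter.1 hx n⟩
  · rintro n _ ⟨y, hy, rfl⟩
    rw [seg_add, F_append]
    exact ⟨_, S.F_maps _ hy, rfl⟩
  · exact fun n => ⟨_, 0, zero_mem, rfl⟩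
  · exact isCompact_Icc.image_of_continuousOn (S.F_cont _)
  · exact fun n => (isCompact_Icc.image_of_continuousOn (S.F_cont _)).isClosed

lemma cod_close [Finite Λ] {ε : ℝ} (hε : 0 < ε) : ∃ n, ∀ τ σ : ℕ → Λ, ∀ x y,
    (∀ k < n, τ k = σ k) → S.Cod τ x → S.Cod σ y → |x - y| ≤ ε := by
  obtain ⟨n, hn⟩ := S.len_small hε
  refine ⟨n, fun τ σ x y h hx hy => ?_⟩
  have e : seg τ 0 n = seg σ 0 n := by rw [seg_eq_iff]; simpa using h
  obtain ⟨x', hx', rfl⟩ := hx n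
  obtain ⟨y', hy', rfl⟩ := hy n
  rw [e]
  exact hn _ (by simp) _ hx' _ hy'

lemma cod_unique [Finite Λ] {τ : ℕ → Λ} {x y : ℝ} (hx : S.Cod τ x) (hy : S.Cod τ y) : x = y := by
  by_contra hne
  have : 0 < |x - y| := abs_pos.2 (sub_ne_zero.2 hne)
  obtain ⟨n, hn⟩ := S.cod_close (half_pos this)
  have := hn τ τ x y (fun _ _ => rfl) hx hy
  linarith

/-- the coded point -/
def pt (τ : ℕ → Λ) : ℝ := (S.cod_exists τ).choose

lemma pt_cod (τ : ℕ → Λ) : S.Cod τ (S.pt τ) := (S.cod_exists τ).choose_spec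

lemma pt_mem (τ : ℕ → Λ) : S.pt τ ∈ Icc (0:ℝ) 1 := S.cod_mem (S.pt_cod τ)

lemma cod_app {τ : ℕ → Λ} {x : ℝ} (w : List Λ) (h : S.Cod τ x) : S.Cod (app w τ) (S.F w x) := by
  intro n
  rcases le_total n w.length with hn | hn
  · obtain ⟨m, hm⟩ := Nat.exists_eq_add_of_le hn
    have e := seg_app w τ
    rw [hm, seg_add] at e
    refine ⟨_, S.F_maps (seg (app w τ) (0 + n) m) (S.cod_mem h), ?_⟩
    rw [← F_append, e]
  · obtain ⟨m, rfl⟩ := Nat.exists_eq_add_of_le hn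
    obtain ⟨y, hy, hyx⟩ := h m
    have := seg_shf (app w τ) w.length 0 m
    rw [shf_app, add_zero] at this
    rw [seg_add, seg_app, zero_add, ← this]
    exact ⟨y, hy, by rw [F_append, hyx]⟩

lemma pt_app [Finite Λ] (w : List Λ) (τ : ℕ → Λ) : S.pt (app w τ) = S.F w (S.pt τ) :=
  S.cod_unique (S.pt_cod _) (S.cod_app w (S.pt_cod τ))

lemma pt_split [Finite Λ] (τ : ℕ → Λ) (n : ℕ) : S.pt τ = S.F (seg τ 0 n) (S.pt (shf n τ)) := by
  rw [← pt_app, app_seg_shf]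

lemma strip [Finite Λ] {σ : ℕ → Λ} {w : List Λ} {x c : ℝ} (hx : x ∈ Icc (0:ℝ) 1)
    (hc : c ∈ Icc (0:ℝ) 1) (h : S.pt σ ∈ S.F w '' uIoo x c) :
    seg σ 0 w.length = w ∧ S.pt (shf w.length σ) ∈ uIoo x c := by
  have e : seg σ 0 w.length = w := by
    by_contra hne
    have := S.closed_disj (S.disj_of_length (by simp) hne) (S.pt_cod σ w.length)
    exact this (image_mono (uIoo_sub hx hc) h)
  refine ⟨e, ?_⟩
  obtain ⟨t, ht, hts⟩ := h
  rw [S.pt_split σ w.length, e] at hts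
  rwa [← S.F_inj w (Ioo_subset_Icc_self (uIoo_sub hx hc ht)) (S.pt_mem _) hts]

lemma three_pt {σ₁ σ₂ σ₃ : ℕ → Λ} (h2 : S.pt σ₁ = S.pt σ₂) (h3 : S.pt σ₁ = S.pt σ₃) :
    σ₁ = σ₂ ∨ σ₁ = σ₃ ∨ σ₂ = σ₃ := by
  by_contra! h
  obtain ⟨a, b, c⟩ := h
  obtain ⟨i, hi⟩ := Function.ne_iff.1 a
  obtain ⟨j, hj⟩ := Function.ne_iff.1 b
  obtain ⟨k, hk⟩ := Function.ne_iff.1 c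
  set n := i + j + k + 1 with hn
  have key : ∀ (α β : ℕ → Λ) (l : ℕ), l < n → α l ≠ β l →
      Disjoint (S.F (seg α 0 n) '' Ioo (0:ℝ) 1) (S.F (seg β 0 n) '' Ioo (0:ℝ) 1) := by
    intro α β l hl hne
    refine S.disj_of_length (by simp) fun e => hne ?_
    have := (seg_eq_iff α β 0 0 n).1 e l hl
    simpa using this
  exact S.three (S.pt_cod σ₁ n) (h2 ▸ S.pt_cod σ₂ n) (h3 ▸ S.pt_cod σ₃ n)
    (key _ _ i (by omega) hi) (key _ _ j (by omega) hj) (key _ _ k (by omega) hk)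

lemma E_eq_sum (w : List Λ) (x y : ℝ) : S.E w x y =
    ∑ i ∈ Finset.range w.length, |S.F (w.drop (i + 1)) x - S.F (w.drop (i + 1)) y| := by
  induction w with
  | nil => simp
  | cons a w ih =>
    rw [E_cons, ih, List.length_cons, Finset.sum_range_succ']
    simp only [List.drop_succ_cons, List.drop_zero]
    ring

end PSys

namespace PSys
variable {Λ : Type} (S : PSys Λ)

/-- the limit set of the orbit of `ω` under the shift -/
def T (ω : ℕ → Λ) : Set (ℕ → Λ) := {τ | ∀ n, ∃ᶠ t in atTop, ∀ k < n, ω (t + k) = τ k}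

lemma T_nonempty [Finite Λ] (ω : ℕ → Λ) : (T ω).Nonempty := konig (fun t k => ω (t + k))

lemma T_shf1 {ω τ : ℕ → Λ} (h : τ ∈ T ω) : shf 1 τ ∈ T ω := by
  intro n
  have h1 := h (n + 1)
  rw [frequently_atTop] at h1 ⊢
  intro a
  obtain ⟨b, hb, hb'⟩ := h1 a
  refine ⟨b + 1, by omega, fun k hk => ?_⟩
  have := hb' (k + 1) (by omega)
  rw [shf, add_comm 1 k, ← this]; congr 1; ring

lemma T_shf {ω τ : ℕ → Λ} (h : τ ∈ T ω) (k : ℕ) : shf k τ ∈ T ω := by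
  induction k with
  | zero => convert h using 1; funext j; simp [shf]
  | succ k ih => rw [← shf_shf]; exact T_shf1 ih

lemma T_notmem {ω τ : ℕ → Λ} (h : τ ∉ T ω) :
    ∃ n N, ∀ m ≥ n, ∀ t ≥ N, ¬ ∀ k < m, ω (t + k) = τ k := by
  have h' : ∃ n, ¬ ∃ᶠ t in atTop, ∀ k < n, ω (t + k) = τ k := by
    by_contra hc
    push Not at hc
    exact h hc
  obtain ⟨n, hn⟩ := h'
  rw [not_frequently, eventually_atTop] at hn
  obtain ⟨N, hN⟩ := hn
  exact ⟨n, N, fun m hm t ht hk => hN t ht fun k hkn => hk k (by omega)⟩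

lemma T_left [Finite Λ] {ω τ : ℕ → Λ} (h : τ ∈ T ω) : ∃ a, app [a] τ ∈ T ω := by
  by_contra! hc
  choose n N hn using fun a => T_notmem (hc a)
  cases nonempty_fintype Λ
  obtain ⟨b, hb, hb'⟩ := frequently_atTop.1 (h (Finset.univ.sup n)) (Finset.univ.sup N + 1)
  have h1 := Finset.le_sup (f := N) (Finset.mem_univ (ω (b - 1)))
  have h2 := Finset.le_sup (f := n) (Finset.mem_univ (ω (b - 1)))
  refine hn (ω (b - 1)) (Finset.univ.sup n + 1) (by omega) (b - 1) (by omega) ?_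
  intro k hk
  cases k with
  | zero => simp
  | succ k =>
    rw [app_cons_succ, app_nil, ← hb' k (by omega)]
    congr 1; omega

/-- every recurrent word is non-hyperbolic -/
def NonHyp (ω : ℕ → Λ) : Prop :=
  ∀ u : List Λ, (∃ᶠ t in atTop, seg ω t u.length = u) → ∃ x ∈ Icc (0:ℝ) 1, S.D u x = 1

lemma recur {ω τ : ℕ → Λ} (h : τ ∈ T ω) (n : ℕ) : ∃ᶠ t in atTop, seg ω t n = seg τ 0 n := by
  refine (h n).mono fun t ht => ?_
  rw [seg_eq_iff]; simpa using ht

lemma D_cons_one {a : Λ} {w : List Λ} {x : ℝ} (hx : x ∈ Icc (0:ℝ) 1) (h : S.D (a :: w) x = 1) :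
    |S.d a (S.F w x)| = 1 := by
  rw [D_cons] at h
  have h1 := S.dle a _ (S.F_maps w hx)
  have h2 := S.D_le_one w hx
  have h3 := S.D_pos w hx
  have h4 := abs_nonneg (S.d a (S.F w x))
  nlinarith

lemma fact1 [Finite Λ] {ω τ : ℕ → Λ} (hM : S.NonHyp ω) {a : Λ} (h : app [a] τ ∈ T ω) :
    |S.d a (S.pt τ)| = 1 := by
  have hc : ContinuousWithinAt (fun x => |S.d a x|) (Icc (0:ℝ) 1) (S.pt τ) :=
    (S.dcont a).abs _ (S.pt_mem τ)
  by_contra hne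
  have hlt : |S.d a (S.pt τ)| < 1 := lt_of_le_of_ne (S.dle a _ (S.pt_mem τ)) hne
  have hev := hc.eventually (gt_mem_nhds hlt)
  rw [eventually_nhdsWithin_iff, Metric.eventually_nhds_iff] at hev
  obtain ⟨ε, hε, hev⟩ := hev
  obtain ⟨n, hn⟩ := S.len_small (half_pos hε)
  obtain ⟨x, hx, hx1⟩ := hM (a :: seg τ 0 n) (by
    have := recur h (n + 1)
    rw [List.length_cons, seg_length]
    have e : seg (app [a] τ) 0 (n + 1) = a :: seg τ 0 n := by
      rw [seg_succ, app_cons_zero, ← add_zero (0 + 1), ← seg_shf,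
        show shf (0 + 1) (app [a] τ) = τ from shf_app [a] τ]
    rwa [e] at this)
  have h1 := S.D_cons_one hx hx1
  have h2 : |S.F (seg τ 0 n) x - S.pt τ| ≤ ε / 2 := by
    rw [S.pt_split τ n]
    exact hn _ (by simp) _ hx _ (S.pt_mem _)
  have h3 := hev (y := S.F (seg τ 0 n) x) (by rw [Real.dist_eq]; linarith) (S.F_maps _ hx)
  linarith

lemma T_app_shf {ω τ : ℕ → Λ} {w v : List Λ} (h : app (w ++ v) τ ∈ T ω) : app v τ ∈ T ω := by
  rw [app_append] at h
  have := T_shf h w.length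
  rwa [shf_app] at this

lemma D_one [Finite Λ] {ω τ : ℕ → Λ} (hM : S.NonHyp ω) {w : List Λ} (h : app w τ ∈ T ω) :
    S.D w (S.pt τ) = 1 := by
  induction w with
  | nil => simp
  | cons a w ih =>
    have h1 : app w τ ∈ T ω := T_app_shf (w := [a]) h
    rw [D_cons, ih h1, mul_one, ← pt_app]
    exact S.fact1 hM (by rw [← app_append]; exact h)

lemma T_seqclosed [Finite Λ] {ω : ℕ → Λ} {Q : ℕ → ℕ → Λ} (hQ : ∀ k, Q k ∈ T ω) {τ : ℕ → Λ}
    (h : ∀ n, ∃ᶠ k in atTop, ∀ j < n, Q k j = τ j) : τ ∈ T ω := by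
  intro n
  obtain ⟨k, hk⟩ := (h n).exists
  exact (hQ k n).mono fun t ht j hj => (ht j hj).trans (hk j hj)

lemma P_closed [Finite Λ] (ω : ℕ → Λ) : IsClosed (S.pt '' T ω) := by
  apply IsSeqClosed.isClosed
  intro y y0 hy hlim
  choose Q hQ hQy using hy
  obtain ⟨τ, hτ⟩ := konig Q
  refine ⟨τ, T_seqclosed hQ hτ, ?_⟩
  by_contra hne
  have hpos : 0 < |S.pt τ - y0| := abs_pos.2 (sub_ne_zero.2 hne)
  obtain ⟨n, hn⟩ := S.cod_close (show 0 < |S.pt τ - y0| / 3 by linarith)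
  have h1 := (Metric.tendsto_nhds.1 hlim) (|S.pt τ - y0| / 3) (by linarith)
  obtain ⟨k, hk1, hk2⟩ := ((hτ n).and_eventually h1).exists
  have h2 := hn (Q k) τ _ _ hk1 (S.pt_cod _) (S.pt_cod _)
  rw [hQy, abs_sub_comm] at h2
  rw [Real.dist_eq] at hk2
  have := abs_sub_le (S.pt τ) (y k) y0
  linarith

lemma P_gap [Finite Λ] {ω : ℕ → Λ} (hM : S.NonHyp ω) : ∃ c ∈ Icc (0:ℝ) 1, c ∉ S.pt '' T ω := by
  by_contra! hc
  obtain ⟨τ, hτ⟩ := T_nonempty ω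
  set a := τ 0
  have key : ∀ x ∈ Ioo (0:ℝ) 1, |S.d a x| = 1 := by
    intro x hx
    have hx' := Ioo_subset_Icc_self hx
    obtain ⟨σ, hσ, hσx⟩ := hc (S.f a x) (S.maps a hx')
    have h1 := S.strip (σ := σ) (w := [a]) zero_mem one_mem (by
      rw [uIoo01, hσx]; exact ⟨x, hx, rfl⟩)
    have e : app [a] (shf 1 σ) = σ := by
      have := app_seg_shf σ 1
      rwa [show seg σ 0 1 = [a] from h1.1] at this
    have h2 := S.fact1 hM (a := a) (τ := shf 1 σ) (by rwa [e])
    have h3 : S.pt (shf 1 σ) = x := by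
      apply S.F_inj [a] (S.pt_mem _) hx'
      rw [← pt_app, e, hσx]; rfl
    rwa [h3] at h2
  obtain ⟨ξ, hξ, h⟩ := S.mvt [a] zero_mem one_mem zero_ne_one
  rw [uIoo01] at hξ
  have h1 := S.contr a 0 zero_mem 1 one_mem zero_ne_one
  simp only [F_cons, F_nil, D_cons, D_nil, key ξ hξ, one_mul] at h
  linarith

/-- `pt τ` is an endpoint of a gap of the set of limit points -/
def Gapend (ω τ : ℕ → Λ) : Prop :=
  τ ∈ T ω ∧ ∃ c ∈ Icc (0:ℝ) 1, c ≠ S.pt τ ∧ ∀ σ ∈ T ω, S.pt σ ∉ uIoo (S.pt τ) c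

lemma gapend_exists [Finite Λ] {ω : ℕ → Λ} (hM : S.NonHyp ω) : ∃ τ, S.Gapend ω τ := by
  obtain ⟨c, hc, hcP⟩ := S.P_gap hM
  obtain ⟨y, ⟨τ, hτ, rfl⟩, hy⟩ := (S.P_closed ω).exists_infDist_eq_dist
    ((T_nonempty ω).image _) c
  refine ⟨τ, hτ, c, hc, fun h => hcP ⟨τ, hτ, h.symm⟩, fun σ hσ h => ?_⟩
  have h1 := Metric.infDist_le_dist_of_mem (x := c) (mem_image_of_mem S.pt hσ)
  rw [hy, Real.dist_eq, Real.dist_eq] at h1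
  rcases lt_or_gt_of_ne (show S.pt τ ≠ c from fun h => hcP ⟨τ, hτ, h⟩) with hlt | hlt
  · rw [uIoo_of_lt hlt] at h
    rw [abs_of_pos (by linarith), abs_of_pos (by linarith [h.2])] at h1
    linarith [h.1]
  · rw [uIoo_of_gt hlt] at h
    rw [abs_of_neg (by linarith), abs_of_neg (by linarith [h.1])] at h1
    linarith [h.2]

lemma gapend_app [Finite Λ] {ω τ : ℕ → Λ} (h : S.Gapend ω τ) {a : Λ} (ha : app [a] τ ∈ T ω) :
    S.Gapend ω (app [a] τ) := by
  obtain ⟨hτ, c, hc, hne, hg⟩ := h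
  refine ⟨ha, S.F [a] c, S.F_maps _ hc, ?_, fun σ hσ h => ?_⟩
  · rw [pt_app]
    exact fun h => hne (S.F_inj [a] hc (S.pt_mem _) h)
  · rw [pt_app] at h
    have := S.strip (S.pt_mem _) hc (S.uIoo_subset_image [a] (S.pt_mem _) hc h)
    exact hg _ (T_shf hσ _) this.2

lemma per_of_fix [Finite Λ] {τ : ℕ → Λ} {m : List Λ} (hm : m ≠ []) (h : S.F m (S.pt τ) = S.pt τ) :
    ∃ p > 0, ∀ k, τ (p + k) = τ k := by
  have hl : 0 < m.length := List.length_pos_iff.2 hm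
  have h1 : S.pt τ = S.pt (app m τ) := by rw [pt_app, h]
  have h2 : S.pt τ = S.pt (app (m ++ m) τ) := by rw [pt_app, F_append, h, h]
  rcases S.three_pt h1 h2 with e | e | e
  · exact ⟨_, hl, fun k => by conv_lhs => rw [e, app_add]⟩
  · refine ⟨(m ++ m).length, by simp [hl], fun k => by conv_lhs => rw [e, app_add]⟩
  · have e' : τ = app m τ := by
      have := congrArg (shf m.length) e
      rwa [app_append, shf_app, shf_app] at this
    exact ⟨_, hl, fun k => by conv_lhs => rw [e', app_add]⟩

lemma T_word [Finite Λ] {ω τ : ℕ → Λ} (h : τ ∈ T ω) (n : ℕ) :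
    ∃ u : List Λ, u.length = n ∧ app u τ ∈ T ω := by
  induction n with
  | zero => exact ⟨[], rfl, h⟩
  | succ n ih =>
    obtain ⟨u, hu, hu'⟩ := ih
    obtain ⟨a, ha⟩ := T_left hu'
    exact ⟨a :: u, by simp [hu], by rw [← app_append] at ha; exact ha⟩

lemma overlap [Finite Λ] {ω τ : ℕ → Λ} {c : ℝ} (hτ : τ ∈ T ω) (hc : c ∈ Icc (0:ℝ) 1)
    (hne : c ≠ S.pt τ) (hg : ∀ σ ∈ T ω, S.pt σ ∉ uIoo (S.pt τ) c) {m : List Λ}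
    (hm : app m τ ∈ T ω) {e : ℝ} (he : e ∈ uIoo (S.pt τ) ((S.pt τ + c) / 2))
    (he' : S.F m e ∈ uIoo (S.pt τ) ((S.pt τ + c) / 2)) : S.F m (S.pt τ) = S.pt τ := by
  set x := S.pt τ with hx
  have hxI : x ∈ Icc (0:ℝ) 1 := S.pt_mem τ
  have hcI : (x + c) / 2 ∈ Icc (0:ℝ) 1 := ⟨by linarith [hxI.1, hc.1], by linarith [hxI.2, hc.2]⟩
  have heI := Ioo_subset_Icc_self (uIoo_sub hxI hcI he)
  have h1 : S.F m x ∉ uIoo x c := by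
    have := hg _ hm; rwa [pt_app] at this
  have h2 := S.F_lip m hxI heI
  have h3 : x ∉ S.F m '' uIoo x ((x + c) / 2) := by
    intro h
    have := (S.strip hxI hcI h).2
    refine hg _ (T_shf hτ m.length) ?_
    rw [uIoo, mem_Ioo] at this ⊢
    refine ⟨lt_of_le_of_lt ?_ this.1, lt_of_lt_of_le this.2 ?_⟩
    · refine le_inf inf_le_left ?_
      rcases le_total x c with h | h
      · exact inf_le_left.trans (by linarith)
      · exact inf_le_right.trans (by linarith)
    · refine sup_le le_sup_left ?_
      rcases le_total x c with h | h
      · exact le_sup_of_le_right (by linarith)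
      · exact le_sup_of_le_left (by linarith)
  have h4 : S.F m e ∈ uIoo (S.F m x) (S.F m ((x + c) / 2)) := by
    rcases S.F_mono m with hm | hm
    · rcases lt_or_gt_of_ne hne with h | h
      · rw [uIoo_of_gt (by linarith)] at he
        have a1 := hm hcI heI he.1
        have a2 := hm heI hxI he.2
        rw [uIoo_of_gt (a1.trans a2)]; exact ⟨a1, a2⟩
      · rw [uIoo_of_lt (by linarith)] at he
        have a1 := hm hxI heI he.1
        have a2 := hm heI hcI he.2
        rw [uIoo_of_lt (a1.trans a2)]; exact ⟨a1, a2⟩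
    · rcases lt_or_gt_of_ne hne with h | h
      · rw [uIoo_of_gt (by linarith)] at he
        have a1 := hm hcI heI he.1
        have a2 := hm heI hxI he.2
        rw [uIoo_of_lt (a2.trans a1)]; exact ⟨a2, a1⟩
      · rw [uIoo_of_lt (by linarith)] at he
        have a1 := hm hxI heI he.1
        have a2 := hm heI hcI he.2
        rw [uIoo_of_gt (a2.trans a1)]; exact ⟨a2, a1⟩
  have h5 : x ∉ uIoo (S.F m x) (S.F m ((x + c) / 2)) :=
    fun h => h3 (S.uIoo_subset_image m hxI hcI h)
  by_contra hfix
  rcases lt_or_gt_of_ne hne with h | h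
  · rw [uIoo_of_gt (by linarith)] at he he'
    rw [uIoo_of_gt h] at h1
    rw [abs_of_pos (show 0 < x - e by linarith [he.2])] at h2
    have a1 := (abs_le.1 h2).1
    have a2 : x < S.F m x := by
      by_contra hh
      exact h1 ⟨by linarith [he.1, he'.1], lt_of_le_of_ne (not_lt.1 hh) hfix⟩
    apply h5
    rw [uIoo, mem_Ioo] at h4 ⊢
    exact ⟨h4.1.trans he'.2, lt_of_lt_of_le a2 le_sup_left⟩
  · rw [uIoo_of_lt (by linarith)] at he he'
    rw [uIoo_of_lt h] at h1
    rw [abs_of_neg (show x - e < 0 by linarith [he.1])] at h2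
    have a1 := (abs_le.1 h2).2
    have a2 : S.F m x < x := by
      by_contra hh
      exact h1 ⟨lt_of_le_of_ne (not_lt.1 hh) (Ne.symm hfix), by linarith [he.2, he'.2]⟩
    apply h5
    rw [uIoo, mem_Ioo] at h4 ⊢
    exact ⟨lt_of_le_of_lt inf_le_left a2, he'.1.trans h4.2⟩

lemma gapend_per [Finite Λ] {ω τ : ℕ → Λ} (hM : S.NonHyp ω) (h : S.Gapend ω τ) :
    ∃ p > 0, ∀ k, τ (p + k) = τ k := by
  obtain ⟨hτ, c, hc, hne, hg⟩ := h
  by_contra hper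
  have hfix : ∀ m : List Λ, m ≠ [] → S.F m (S.pt τ) ≠ S.pt τ :=
    fun m hm h => hper (S.per_of_fix hm h)
  set x := S.pt τ with hx
  have hxI : x ∈ Icc (0:ℝ) 1 := S.pt_mem τ
  set c' := (x + c) / 2 with hc'
  have hcI : c' ∈ Icc (0:ℝ) 1 := ⟨by linarith [hxI.1, hc.1], by linarith [hxI.2, hc.2]⟩
  have hne' : x ≠ c' := fun h => hne (by linarith)
  have hpos : 0 < |x - c'| := abs_pos.2 (sub_ne_zero.2 hne')
  obtain ⟨n, hn⟩ := S.len_small (show 0 < Real.exp (-S.C) * |x - c'| / 2 by positivity)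
  obtain ⟨u, hu, huT⟩ := T_word hτ n
  obtain ⟨ξ, hξ, hmv⟩ := S.mvt u hxI hcI hne'
  have hξI := Ioo_subset_Icc_self (uIoo_sub hxI hcI hξ)
  have hsub : uIoo x ξ ⊆ uIoo x c' := by
    intro z hz
    rw [uIoo, mem_Ioo] at hξ hz ⊢
    exact ⟨lt_of_le_of_lt (le_inf inf_le_left hξ.1.le) hz.1,
      lt_of_lt_of_le hz.2 (sup_le le_sup_left hξ.2.le)⟩
  have key : ∀ i j, i < j → j < u.length → Disjoint (S.F (u.drop (i + 1)) '' uIoo x c')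
      (S.F (u.drop (j + 1)) '' uIoo x c') := by
    intro i j hij hj
    rw [Set.disjoint_left]
    rintro _ ⟨e, he, rfl⟩ ⟨e', he', hee⟩
    have hpre := S.prefix_of_inter (w := u.drop (i + 1)) (w' := u.drop (j + 1)) (by
      rw [Set.not_disjoint_iff]
      exact ⟨_, ⟨e, uIoo_sub hxI hcI he, rfl⟩, ⟨e', uIoo_sub hxI hcI he', hee⟩⟩)
    have hpre' : u.drop (j + 1) <+: u.drop (i + 1) := by
      rcases hpre with h | h
      · exact absurd h.length_le (by simp only [List.length_drop]; omega)
      · exact h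
    obtain ⟨m, hm⟩ := hpre'
    have hmne : m ≠ [] := by
      rintro rfl
      have := congrArg List.length hm
      simp only [List.length_drop, List.append_nil] at this; omega
    have hu2 : u = (u.take (i + 1) ++ u.drop (j + 1)) ++ m := by
      rw [List.append_assoc, hm, List.take_append_drop]
    have hmT : app m τ ∈ T ω := by
      rw [hu2] at huT; exact T_app_shf huT
    rw [← hm, F_append] at hee
    have he1 := Ioo_subset_Icc_self (uIoo_sub hxI hcI he)
    have he2 := Ioo_subset_Icc_self (uIoo_sub hxI hcI he')
    have hee' := S.F_inj _ he2 (S.F_maps _ he1) hee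
    exact hfix m hmne (S.overlap hτ hc hne hg hmT he (hee' ▸ he'))
  have hE : S.E u x ξ ≤ 1 := by
    rw [E_eq_sum]
    refine S.sum_le_one _ (fun i => u.drop (i + 1)) hxI hξI ?_
    intro i hi j hj hij
    rw [Finset.mem_range] at hi hj
    rcases lt_or_gt_of_ne hij with h | h
    · exact (key i j h hj).mono (image_mono hsub) (image_mono hsub)
    · exact (key j i h hi).symm.mono (image_mono hsub) (image_mono hsub)
  have h1 := S.D_le_exp u hxI hξI
  rw [S.D_one hM huT] at h1
  have h2 : Real.exp (S.C * S.E u x ξ) ≤ Real.exp S.C :=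
    Real.exp_le_exp.2 (by nlinarith [S.C_nonneg])
  have h3 : Real.exp (-S.C) ≤ S.D u ξ := by
    rw [Real.exp_neg, inv_le_iff_one_le_mul₀ (Real.exp_pos _)]
    have := S.D_pos u hξI
    nlinarith
  have h4 := hn u hu.ge _ hxI _ hcI
  rw [hmv] at h4
  have h5 := Real.exp_pos (-S.C)
  nlinarith

lemma per_mul {τ : ℕ → Λ} {p : ℕ} (h : ∀ k, τ (p + k) = τ k) (q k : ℕ) : τ (q * p + k) = τ k := by
  induction q with
  | zero => simp
  | succ q ih => rw [← ih, ← h (q * p + k)]; congr 1; ring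

lemma left_unique [Finite Λ] {ω τ : ℕ → Λ} (hM : S.NonHyp ω) (h : S.Gapend ω τ) {a b : Λ}
    (ha : app [a] τ ∈ T ω) (hb : app [b] τ ∈ T ω) : a = b := by
  obtain ⟨p, hp, hp'⟩ := S.gapend_per hM (S.gapend_app h ha)
  obtain ⟨q, hq, hq'⟩ := S.gapend_per hM (S.gapend_app h hb)
  have h1 := per_mul hp' q 0
  have h2 := per_mul hq' p 0
  have hpq : 0 < q * p := Nat.mul_pos hq hp
  rw [app_cons_zero, add_zero] at h1 h2
  rw [mul_comm p q] at h2
  obtain ⟨r, hr⟩ := Nat.exists_eq_succ_of_ne_zero hpq.ne'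
  rw [hr, Nat.succ_eq_add_one, app_cons_succ] at h1 h2
  rw [← h1, ← h2]

/-- Claim (M). -/
theorem claimM [Finite Λ] {ω : ℕ → Λ} (hM : S.NonHyp ω) :
    ∃ N p, 0 < p ∧ ∀ k ≥ N, ω (k + p) = ω k := by
  obtain ⟨τ, hτ⟩ := S.gapend_exists hM
  obtain ⟨p, hp, hper⟩ := S.gapend_per hM hτ
  have e0 : ∀ j, shf j τ = app [τ j] (shf (j + 1) τ) := by
    intro j
    funext k
    cases k with
    | zero => simp [shf]
    | succ k => simp only [app_cons_succ, app_nil, shf]; congr 1; ring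
  have hG : ∀ j, S.Gapend ω (shf j τ) := by
    have h1 : ∀ i n, i ≤ n * p → S.Gapend ω (shf (n * p - i) τ) := by
      intro i n
      induction i with
      | zero =>
        intro _
        convert hτ using 1
        funext k; simp [shf, per_mul hper]
      | succ i ih =>
        intro hi
        have := ih (by omega)
        rw [show n * p - i = n * p - (i + 1) + 1 by omega] at this
        rw [e0]
        refine S.gapend_app this ?_
        rw [← e0]; exact T_shf hτ.1 _
    intro j
    have := h1 (j * p - j) j (by omega)
    have hle : j ≤ j * p := Nat.le_mul_of_pos_right _ hp
    rwa [show j * p - (j * p - j) = j by omega] at this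
  have hdet : ∀ j, ∃ n N, ∀ m ≥ n, ∀ t ≥ N, (∀ k < m, ω (t + 1 + k) = τ (j + 1 + k)) →
      ω t = τ j := by
    intro j
    have h1 : ∀ a, ∃ n N, a ≠ τ j → ∀ m ≥ n, ∀ t ≥ N,
        ¬ ∀ k < m, ω (t + k) = app [a] (shf (j + 1) τ) k := by
      intro a
      by_cases ha : a = τ j
      · exact ⟨0, 0, fun h => absurd ha h⟩
      · obtain ⟨n, N, h⟩ := T_notmem (ω := ω) (τ := app [a] (shf (j + 1) τ)) (fun hT => ha
          (S.left_unique hM (hG (j + 1)) hT (by rw [← e0]; exact T_shf hτ.1 _)))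
        exact ⟨n, N, fun _ => h⟩
    choose n N h using h1
    cases nonempty_fintype Λ
    refine ⟨Finset.univ.sup n, Finset.univ.sup N, fun m hm t ht hk => ?_⟩
    by_contra hne
    have h3 := Finset.le_sup (f := N) (Finset.mem_univ (ω t))
    have h2 := Finset.le_sup (f := n) (Finset.mem_univ (ω t))
    refine h (ω t) hne (m + 1) (by omega) t (by omega) fun k hkm => ?_
    cases k with
    | zero => simp
    | succ k =>
      rw [app_cons_succ, app_nil, shf, ← hk k (by omega)]; congr 1; ring
  choose n N h using hdet
  set n0 := (Finset.range p).sup n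
  set N0 := (Finset.range p).sup N
  have hdet' : ∀ j, ∀ t ≥ N0, (∀ k < n0, ω (t + 1 + k) = τ (j + 1 + k)) → ω t = τ j := by
    intro j t ht hk
    have hj : j % p ∈ Finset.range p := Finset.mem_range.2 (Nat.mod_lt _ hp)
    have h3 := Finset.le_sup (f := N) hj
    have h2 := Finset.le_sup (f := n) hj
    have hmod : ∀ r, τ (j + r) = τ (j % p + r) := by
      intro r
      rw [← per_mul hper (j / p) (j % p + r)]
      congr 1
      have := Nat.div_add_mod j p
      rw [mul_comm]; omega
    have := h (j % p) n0 h2 t (by omega) fun k hkn => by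
      rw [hk k hkn, add_assoc, add_assoc, hmod]
    rw [this]
    simpa using (hmod 0).symm
  refine ⟨N0, p, hp, fun k hk => ?_⟩
  obtain ⟨t0, ht0, hτ0⟩ := frequently_atTop.1 (hτ.1 n0) (k + p + 1)
  set K := t0 * p - t0 with hK
  have hle : t0 ≤ t0 * p := Nat.le_mul_of_pos_right _ hp
  have main : ∀ i ≤ t0 - N0, ∀ r, t0 - i ≤ r → r < t0 + n0 → ω r = τ (r + K) := by
    intro i
    induction i with
    | zero =>
      intro _ r hr hr'
      obtain ⟨s, rfl⟩ := Nat.exists_eq_add_of_le (show t0 ≤ r by omega)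
      rw [hτ0 s (by omega), show t0 + s + K = t0 * p + s by omega, per_mul hper]
    | succ i ih =>
      intro hi r hr hr'
      have ih' := ih (by omega)
      by_cases hri : t0 - i ≤ r
      · exact ih' r hri hr'
      · refine hdet' (r + K) r (by omega) fun k hk => ?_
        rw [ih' (r + 1 + k) (by omega) (by omega)]; congr 1; ring
  have h1 := main (t0 - k) (by omega) k (by omega) (by omega)
  have h2 := main (t0 - k) (by omega) (k + p) (by omega) (by omega)
  rw [h1, h2, ← hper (k + K)]; congr 1; ring

end PSys

namespace PSys
variable {Λ : Type} (S : PSys Λ)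

lemma E_lin {b : List Λ} {A : ℝ}
    (hA : ∀ x ∈ Icc (0:ℝ) 1, ∀ y ∈ Icc (0:ℝ) 1, S.E b x y ≤ A) :
    ∀ x ∈ Icc (0:ℝ) 1, ∀ y ∈ Icc (0:ℝ) 1, S.E b x y ≤ (Real.exp (S.C * A) * A) * |x - y| := by
  intro x hx y hy
  by_cases hxy : x = y
  · subst hxy; rw [E_eq_sum]; simp
  have h1 : ∀ i, |S.F (b.drop i) x - S.F (b.drop i) y| ≤
      (Real.exp (S.C * A) * |x - y|) * |S.F (b.drop i) 0 - S.F (b.drop i) 1| := by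
    intro i
    obtain ⟨ξ, hξ, e1⟩ := S.mvt (b.drop i) hx hy hxy
    obtain ⟨η, hη, e2⟩ := S.mvt (b.drop i) zero_mem one_mem zero_ne_one
    have hξ' := Ioo_subset_Icc_self (uIoo_sub hx hy hξ)
    have hη' := Ioo_subset_Icc_self (uIoo_sub zero_mem one_mem hη)
    rw [e1, e2]
    have h2 := S.D_le_exp (b.drop i) hξ' hη'
    have h3 : S.E (b.drop i) ξ η ≤ A := by
      refine le_trans ?_ (hA ξ hξ' η hη')
      conv_rhs => rw [← List.take_append_drop i b, E_append]
      linarith [S.E_nonneg (b.take i) (S.F (b.drop i) ξ) (S.F (b.drop i) η)]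
    have h4 : Real.exp (S.C * S.E (b.drop i) ξ η) ≤ Real.exp (S.C * A) :=
      Real.exp_le_exp.2 (mul_le_mul_of_nonneg_left h3 S.C_nonneg)
    have h5 := S.D_pos (b.drop i) hη'
    have h6 : S.D (b.drop i) ξ ≤ Real.exp (S.C * A) * S.D (b.drop i) η :=
      h2.trans (mul_le_mul_of_nonneg_right h4 h5.le)
    have : |(0:ℝ) - 1| = 1 := by norm_num
    rw [this, mul_one]
    calc _ ≤ (Real.exp (S.C * A) * S.D (b.drop i) η) * |x - y| :=
          mul_le_mul_of_nonneg_right h6 (abs_nonneg _)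
      _ = _ := by ring
  calc S.E b x y ≤ (Real.exp (S.C * A) * |x - y|) * S.E b 0 1 := by
        rw [E_eq_sum, E_eq_sum, Finset.mul_sum]
        exact Finset.sum_le_sum fun i _ => h1 _
    _ ≤ (Real.exp (S.C * A) * |x - y|) * A :=
        mul_le_mul_of_nonneg_left (hA 0 zero_mem 1 one_mem) (by positivity)
    _ = _ := by ring

lemma seg_drop (ω : ℕ → Λ) (t n k : ℕ) : (seg ω t (k + n)).drop k = seg ω (t + k) n := by
  rw [seg_add]
  exact List.drop_left' (by simp)

lemma block {ω : ℕ → Λ} {u : List Λ} {t r : ℕ}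
    (hu : seg ω (t + r) u.length = u) (hmin : ∀ r' < r, seg ω (t + r') u.length ≠ u) :
    ∀ x ∈ Icc (0:ℝ) 1, ∀ y ∈ Icc (0:ℝ) 1, S.E (seg ω t (r + u.length)) x y ≤ u.length + 1 := by
  intro x hx y hy
  have key : ∀ i j, i < j → j < r → Disjoint (S.F ((seg ω t (r + u.length)).drop (i + 1)) '' Ioo 0 1)
      (S.F ((seg ω t (r + u.length)).drop (j + 1)) '' Ioo 0 1) := by
    intro i j hij hj
    by_contra hd
    obtain ⟨a, ha⟩ : ∃ a, r = (j + 1) + a := Nat.exists_eq_add_of_le (by omega)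
    have e1 : (seg ω t (r + u.length)).drop (j + 1) = seg ω (t + (j + 1)) (a + u.length) := by
      rw [show r + u.length = (j + 1) + (a + u.length) by omega, seg_drop]
    have e2 : (seg ω t (r + u.length)).drop (i + 1) =
        seg ω (t + (i + 1)) (a + u.length + (j - i)) := by
      rw [show r + u.length = (i + 1) + (a + u.length + (j - i)) by omega, seg_drop]
    have hpre := S.prefix_of_inter hd
    rw [e1, e2] at hpre
    have hpre' : seg ω (t + (j + 1)) (a + u.length) <+:
        seg ω (t + (i + 1)) (a + u.length + (j - i)) := by
      rcases hpre with h | h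
      · exact absurd h.length_le (by simp only [seg_length]; omega)
      · exact h
    have h3 : seg ω (t + (j + 1)) (a + u.length) = seg ω (t + (i + 1)) (a + u.length) := by
      have := List.prefix_iff_eq_take.1 hpre'
      rw [seg_add _ _ (a + u.length), seg_length] at this
      rw [this]
      exact List.take_left' (by simp)
    have h4 := congrArg (List.drop a) h3
    rw [seg_drop, seg_drop] at h4
    refine hmin (i + 1 + a) (by omega) ?_
    rw [show t + (i + 1 + a) = t + (i + 1) + a by ring, ← h4,
      show t + (j + 1) + a = t + r by omega, hu]
  have hsum := S.sum_le_one (Finset.range r) (fun i => (seg ω t (r + u.length)).drop (i + 1)) hx hy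
    (by
      intro i hi j hj hij
      rw [Finset.mem_range] at hi hj
      have hsub := uIoo_sub hx hy
      rcases lt_or_gt_of_ne hij with h | h
      · exact (key i j h hj).mono (image_mono hsub) (image_mono hsub)
      · exact (key j i h hi).symm.mono (image_mono hsub) (image_mono hsub))
  rw [E_eq_sum, seg_length, Finset.sum_range_add]
  have h2 : ∑ i ∈ Finset.range u.length, |S.F ((seg ω t (r + u.length)).drop (r + i + 1)) x -
      S.F ((seg ω t (r + u.length)).drop (r + i + 1)) y| ≤ u.length := by
    calc _ ≤ ∑ i ∈ Finset.range u.length, (1:ℝ) := Finset.sum_le_sum fun i _ => by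
          refine (S.F_lip _ hx hy).trans ?_
          rw [abs_le]; constructor <;> linarith [hx.1, hx.2, hy.1, hy.2]
      _ = _ := by simp
  linarith

/-- Second version of Claim (M). -/
theorem claimM' [Finite Λ] {ω : ℕ → Λ} (h : ¬ ∃ N p, 0 < p ∧ ∀ k ≥ N, ω (k + p) = ω k) :
    ∃ Dc : ℝ, ∃ᶠ n in atTop, ∀ x ∈ Icc (0:ℝ) 1, ∀ y ∈ Icc (0:ℝ) 1,
      S.D (seg ω 0 n) x ≤ Dc * S.D (seg ω 0 n) y := by
  have h1 : ¬ S.NonHyp ω := fun hM => h (S.claimM hM)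
  unfold NonHyp at h1
  push Not at h1
  obtain ⟨u, hu, hD⟩ := h1
  have hune : 0 < u.length := by
    rw [List.length_pos_iff]
    rintro rfl
    exact hD 0 zero_mem (by simp)
  obtain ⟨x0, hx0, hmax⟩ := isCompact_Icc.exists_isMaxOn ⟨0, zero_mem⟩ (S.D_cont u)
  set ρ := S.D u x0 with hρ
  have hρ1 : ρ < 1 := lt_of_le_of_ne (S.D_le_one u hx0) (hD x0 hx0)
  set A : ℝ := u.length + 1 with hA
  have hA0 : 0 < A := by positivity
  set L := Real.exp (S.C * A) * A with hL
  have hL0 : 0 < L := by positivity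
  set A' := L / (1 - ρ) with hA'
  have hA'0 : 0 ≤ A' := div_nonneg hL0.le (by linarith)
  have hA'e : L + A' * ρ ≤ A' := by
    have : A' * (1 - ρ) = L := div_mul_cancel₀ _ (by linarith)
    linarith
  have step : ∀ t, (∀ x ∈ Icc (0:ℝ) 1, ∀ y ∈ Icc (0:ℝ) 1, S.E (seg ω 0 t) x y ≤ A' * |x - y|) →
      ∃ t' > t, ∀ x ∈ Icc (0:ℝ) 1, ∀ y ∈ Icc (0:ℝ) 1, S.E (seg ω 0 t') x y ≤ A' * |x - y| := by
    intro t ht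
    classical
    have hex : ∃ r, seg ω (t + r) u.length = u := by
      obtain ⟨b, hb, hb'⟩ := frequently_atTop.1 hu t
      obtain ⟨r, rfl⟩ := Nat.exists_eq_add_of_le hb
      exact ⟨r, hb'⟩
    set r := Nat.find hex
    have hr : seg ω (t + r) u.length = u := Nat.find_spec hex
    have hmin : ∀ r' < r, seg ω (t + r') u.length ≠ u := fun r' h => Nat.find_min hex h
    refine ⟨t + (r + u.length), by omega, ?_⟩
    rw [seg_add, zero_add]
    refine S.E_concat hA'e hA'0 ht (S.E_lin (S.block hr hmin)) fun x hx => ?_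
    rw [seg_add, hr, D_append]
    have a1 : S.D u x ≤ ρ := hmax hx
    have a2 := S.D_le_one (seg ω t r) (S.F_maps u hx)
    have a3 := S.D_pos u hx
    nlinarith
  have hall : ∀ a, ∃ t ≥ a, ∀ x ∈ Icc (0:ℝ) 1, ∀ y ∈ Icc (0:ℝ) 1,
      S.E (seg ω 0 t) x y ≤ A' * |x - y| := by
    intro a
    induction a with
    | zero => exact ⟨0, le_rfl, fun x _ y _ => by simp; positivity⟩
    | succ a ih =>
      obtain ⟨t, ht, h⟩ := ih
      obtain ⟨t', ht', h'⟩ := step t h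
      exact ⟨t', by omega, h'⟩
  refine ⟨Real.exp (S.C * A'), frequently_atTop.2 fun a => ?_⟩
  obtain ⟨t, ht, h⟩ := hall a
  refine ⟨t, ht, fun x hx y hy => (S.D_le_exp _ hx hy).trans ?_⟩
  refine mul_le_mul_of_nonneg_right (Real.exp_le_exp.2
    (mul_le_mul_of_nonneg_left ((h x hx y hy).trans ?_) S.C_nonneg)) (S.D_pos _ hy).le
  have : |x - y| ≤ 1 := by rw [abs_le]; constructor <;> linarith [hx.1, hx.2, hy.1, hy.2]
  nlinarith

end PSys

namespace PSys
variable {Λ : Type} (S : PSys Λ)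

open MeasureTheory in
lemma dim_cover {β : Type} [Countable β] {Y : Set ℝ} (Mk : ℕ → Finset β) (t : β → Set ℝ) {D0 M s1 : ℝ}
    {s2 : ℝ≥0} {K : ℕ} (hD0 : 0 < D0) (hs : s1 < s2)
    (hdiam : ∀ k, ∀ w ∈ Mk k, ∀ x ∈ t w, ∀ y ∈ t w, |x - y| ≤ D0 * (1 / 2) ^ k)
    (hcount : ∀ k ≥ K, ((Mk k).card : ℝ) * ((1 / 2 : ℝ) ^ k) ^ s1 ≤ M)
    (hcov : ∀ x ∈ Y, ∀ n, ∃ k ≥ n, ∃ w ∈ Mk k, x ∈ t w) : dimH Y ≤ s2 := by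
  apply dimH_le_of_hausdorffMeasure_ne_top
  set q : ℝ := (1 / 2 : ℝ) ^ ((s2 : ℝ) - s1) with hq
  have hq0 : 0 < q := by positivity
  have hq1 : q < 1 := Real.rpow_lt_one (by norm_num) (by norm_num) (by linarith)
  have hM0 : 0 ≤ M := le_trans (by positivity) (hcount K le_rfl)
  set c : ℝ := M * D0 ^ (s2 : ℝ) with hc
  have hc0 : 0 ≤ c := by positivity
  have hed : ∀ k, ∀ w ∈ Mk k, ediam (t w) ≤ ENNReal.ofReal (D0 * (1 / 2) ^ k) := by
    intro k w hw
    refine Metric.ediam_le fun x hx y hy => ?_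
    rw [edist_dist, Real.dist_eq]
    exact ENNReal.ofReal_le_ofReal (hdiam k w hw x hx y hy)
  have hterm : ∀ k ≥ K, ((Mk k).card : ℝ≥0∞) * (ENNReal.ofReal (D0 * (1 / 2) ^ k)) ^ (s2 : ℝ) ≤
      ENNReal.ofReal (c * q ^ k) := by
    intro k hk
    rw [ENNReal.ofReal_rpow_of_nonneg (by positivity) s2.coe_nonneg, ← ENNReal.ofReal_natCast,
      ← ENNReal.ofReal_mul (by positivity)]
    apply ENNReal.ofReal_le_ofReal
    have h1 : ((1 / 2 : ℝ) ^ k) ^ (s2 : ℝ) = ((1 / 2 : ℝ) ^ k) ^ s1 * q ^ k := by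
      rw [hq, ← Real.rpow_natCast, ← Real.rpow_natCast, ← Real.rpow_mul (by norm_num),
        ← Real.rpow_mul (by norm_num), ← Real.rpow_mul (by norm_num),
        ← Real.rpow_add (by norm_num)]
      congr 1; ring
    rw [Real.mul_rpow hD0.le (by positivity), h1]
    calc _ = (((Mk k).card : ℝ) * ((1 / 2 : ℝ) ^ k) ^ s1) * (D0 ^ (s2 : ℝ) * q ^ k) := by ring
      _ ≤ M * (D0 ^ (s2 : ℝ) * q ^ k) := mul_le_mul_of_nonneg_right (hcount k hk) (by positivity)
      _ = _ := by rw [hc]; ring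
  set B : ℝ≥0∞ := ∑' j : ℕ, ENNReal.ofReal (c * q ^ j) with hB
  have hBt : B ≠ ⊤ := by
    have : Summable fun j : ℕ => c * q ^ j :=
      (summable_geometric_of_lt_one hq0.le hq1).mul_left c
    exact this.tsum_ofReal_ne_top
  refine ne_top_of_le_ne_top hBt ?_
  have hmain := Measure.hausdorffMeasure_le_liminf_tsum
    (ι := fun n : ℕ => (Σ j : ℕ, {w // w ∈ Mk (n + j)})) (s2 : ℝ) Y (l := atTop)
    (fun n => ENNReal.ofReal (D0 * (1 / 2) ^ n)) ?_ (fun n i => t i.2.1) ?_ ?_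
  · refine hmain.trans (liminf_le_of_frequently_le' (Eventually.frequently ?_))
    filter_upwards [eventually_ge_atTop K] with n hn
    rw [ENNReal.tsum_sigma (fun j (w : {w // w ∈ Mk (n + j)}) => ediam (t w.1) ^ (s2 : ℝ))]
    refine ENNReal.tsum_le_tsum fun j => ?_
    rw [tsum_fintype]
    calc _ ≤ ∑ w : {w // w ∈ Mk (n + j)}, (ENNReal.ofReal (D0 * (1 / 2) ^ (n + j))) ^ (s2 : ℝ) :=
          Finset.sum_le_sum fun w _ => ENNReal.rpow_le_rpow (hed _ _ w.2) s2.coe_nonneg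
      _ = ((Mk (n + j)).card : ℝ≥0∞) * (ENNReal.ofReal (D0 * (1 / 2) ^ (n + j))) ^ (s2 : ℝ) := by
          simp
      _ ≤ ENNReal.ofReal (c * q ^ (n + j)) := hterm _ (by omega)
      _ ≤ _ := by
          apply ENNReal.ofReal_le_ofReal
          refine mul_le_mul_of_nonneg_left ?_ hc0
          exact pow_le_pow_of_le_one hq0.le hq1.le (by omega)
  · rw [← ENNReal.ofReal_zero]
    refine ENNReal.tendsto_ofReal ?_
    rw [← mul_zero D0]
    exact (tendsto_pow_atTop_nhds_zero_of_lt_one (by norm_num) (by norm_num)).const_mul D0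
  · refine Eventually.of_forall fun n i => (hed _ _ i.2.2).trans ?_
    apply ENNReal.ofReal_le_ofReal
    refine mul_le_mul_of_nonneg_left ?_ hD0.le
    exact pow_le_pow_of_le_one (by norm_num) (by norm_num) (by omega)
  · refine Eventually.of_forall fun n x hx => ?_
    obtain ⟨k, hk, w, hw, hxw⟩ := hcov x hx n
    obtain ⟨j, rfl⟩ := Nat.exists_eq_add_of_le hk
    exact mem_iUnion.2 ⟨⟨j, w, hw⟩, hxw⟩

/-- words with distortion at most `D0` -/
def Good (D0 : ℝ) (w : List Λ) : Prop :=
  ∀ x ∈ Icc (0:ℝ) 1, ∀ y ∈ Icc (0:ℝ) 1, S.D w x ≤ D0 * S.D w y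

/-- points with infinitely many good prefixes -/
def XD (D0 : ℝ) : Set ℝ := {x | ∃ ω, S.Cod ω x ∧ ∃ᶠ n in atTop, S.Good D0 (seg ω 0 n)}

/-- good words of a given size -/
def Wk (D0 : ℝ) (k : ℕ) : Set (List Λ) :=
  {w | S.Good D0 w ∧ (1 / 2 : ℝ) ^ (k + 1) < S.D w 0 ∧ S.D w 0 ≤ (1 / 2) ^ k}

lemma good_small [Finite Λ] {D0 ε : ℝ} (hD0 : 0 < D0) (hε : 0 < ε) :
    ∃ n, ∀ w, S.Good D0 w → n ≤ w.length → S.D w 0 ≤ ε := by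
  obtain ⟨n, hn⟩ := S.len_small (show 0 < ε / D0 by positivity)
  refine ⟨n, fun w hw hl => ?_⟩
  obtain ⟨η, hη, e⟩ := S.mvt w zero_mem one_mem zero_ne_one
  have h1 := hn w hl 0 zero_mem 1 one_mem
  have h2 := hw 0 zero_mem η (Ioo_subset_Icc_self (uIoo_sub zero_mem one_mem hη))
  rw [e, show |(0:ℝ) - 1| = 1 by norm_num, mul_one, le_div_iff₀ hD0] at h1
  linarith

lemma Wk_finite [Finite Λ] {D0 : ℝ} (hD0 : 0 < D0) (k : ℕ) : (S.Wk D0 k).Finite := by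
  obtain ⟨n, hn⟩ := S.good_small hD0 (show (0:ℝ) < (1 / 2) ^ (k + 1) by positivity)
  refine (List.finite_length_lt Λ n).subset fun w hw => ?_
  by_contra hl
  have := hn w hw.1 (not_lt.1 hl)
  exact absurd hw.2.1 (not_lt.2 this)

/-- The upper bound. -/
theorem upper [Finite Λ] {D0 s1 : ℝ} {s2 : ℝ≥0} (hD0 : 1 ≤ D0) (hs : s1 < s2)
    (hdim : (s2 : ℝ≥0∞) < dimH (S.XD D0)) (M : ℝ) (K : ℕ) :
    ∃ k ≥ K, ∃ W : Finset (List Λ),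
      (∀ w ∈ W, ∀ x ∈ Icc (0:ℝ) 1, (1 / 2) ^ k / (2 * D0) ≤ S.D w x ∧ S.D w x ≤ D0 * (1 / 2) ^ k) ∧
      (∀ w ∈ W, ∀ w' ∈ W, w ≠ w' →
        Disjoint (S.F w '' Ioo (0:ℝ) 1) (S.F w' '' Ioo (0:ℝ) 1)) ∧
      M < (W.card : ℝ) * ((1 / 2 : ℝ) ^ k) ^ s1 := by
  classical
  have hD0' : 0 < D0 := by linarith
  set Mk : ℕ → Finset (List Λ) := fun k => (S.Wk_finite hD0' k).toFinset.filter
    fun w => ∀ w' ∈ S.Wk D0 k, w' <+: w → w' = w with hMk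
  have hmem : ∀ k w, w ∈ Mk k ↔ w ∈ S.Wk D0 k ∧ ∀ w' ∈ S.Wk D0 k, w' <+: w → w' = w := by
    intro k w; simp [hMk]
  have hb : ∀ k, ∀ w ∈ Mk k, ∀ x ∈ Icc (0:ℝ) 1,
      (1 / 2) ^ k / (2 * D0) ≤ S.D w x ∧ S.D w x ≤ D0 * (1 / 2) ^ k := by
    intro k w hw x hx
    obtain ⟨⟨hg, h1, h2⟩, -⟩ := (hmem k w).1 hw
    constructor
    · rw [div_le_iff₀ (by positivity)]
      have := hg 0 zero_mem x hx
      rw [pow_succ] at h1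
      nlinarith
    · have := hg x hx 0 zero_mem
      nlinarith
  by_contra! hcon
  refine absurd hdim (not_lt.2 ?_)
  refine dim_cover Mk (fun w => S.F w '' Icc (0:ℝ) 1) hD0' hs (M := M) (K := K) ?_ ?_ ?_
  · rintro k w hw _ ⟨x, hx, rfl⟩ _ ⟨y, hy, rfl⟩
    by_cases hxy : x = y
    · subst hxy; simp; positivity
    · obtain ⟨ξ, hξ, e⟩ := S.mvt w hx hy hxy
      have h1 := (hb k w hw ξ (Ioo_subset_Icc_self (uIoo_sub hx hy hξ))).2
      have h2 : |x - y| ≤ 1 := by rw [abs_le]; constructor <;> linarith [hx.1, hx.2, hy.1, hy.2]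
      rw [e]
      have h3 : 0 ≤ D0 * (1 / 2) ^ k := by positivity
      nlinarith [abs_nonneg (x - y)]
  · intro k hk
    refine hcon k hk (Mk k) (hb k) ?_
    intro w hw w' hw' hne
    by_contra hd
    have a := (hmem k w).1 hw
    have b := (hmem k w').1 hw'
    rcases S.prefix_of_inter hd with h | h
    · exact hne (b.2 w a.1 h)
    · exact hne (a.2 w' b.1 h).symm
  · rintro x ⟨ω, hω, hfr⟩ n
    obtain ⟨l, hl⟩ := S.good_small hD0' (show (0:ℝ) < (1 / 2) ^ (n + 1) by positivity)
    obtain ⟨m, hm, hgood⟩ := frequently_atTop.1 hfr l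
    have hsm := hl _ hgood (by simpa using hm)
    have hpos := S.D_pos (seg ω 0 m) zero_mem
    obtain ⟨k, hk1, hk2⟩ := exists_nat_pow_near_of_lt_one hpos (S.D_le_one _ zero_mem)
      (show (0:ℝ) < 1 / 2 by norm_num) (by norm_num)
    have hkn : n ≤ k := by
      have := lt_of_lt_of_le hk1 hsm
      have := (pow_lt_pow_iff_right_of_lt_one₀ (by norm_num) (by norm_num)).1 this
      omega
    have hW : seg ω 0 m ∈ S.Wk D0 k := ⟨hgood, hk1, hk2⟩
    have hex : ∃ j, ∃ w ∈ S.Wk D0 k, w <+: seg ω 0 m ∧ w.length = j :=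
      ⟨_, _, hW, List.prefix_rfl, rfl⟩
    obtain ⟨w, hwW, hwp, hwl⟩ := Nat.find_spec hex
    refine ⟨k, hkn, w, (hmem k w).2 ⟨hwW, fun w' hw' hp => ?_⟩, ?_⟩
    · have := Nat.find_min' hex ⟨w', hw', hp.trans hwp, rfl⟩
      exact hp.eq_of_length (le_antisymm hp.length_le (by omega))
    · obtain ⟨v, hv⟩ := hwp
      obtain ⟨y, hy, hyx⟩ := hω m
      rw [← hv, F_append] at hyx
      exact ⟨_, S.F_maps _ hy, hyx⟩

end PSys

namespace PSys
variable {Λ : Type} (S : PSys Λ)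

lemma zero_unique {w w' : List Λ} (hl : w.length = w'.length) (h : (0:ℝ) ∈ S.F w '' Icc (0:ℝ) 1)
    (h' : (0:ℝ) ∈ S.F w' '' Icc (0:ℝ) 1) : w = w' := by
  by_contra hne
  have hr : ∀ v : List Λ, (0:ℝ) ∈ S.F v '' Icc (0:ℝ) 1 →
      S.F v '' Ioo 0 1 ∈ nhdsWithin (0:ℝ) (Ioi 0) := by
    intro v hv
    rcases S.side v hv with h | h
    · exfalso
      obtain ⟨_, ⟨y, hy, rfl⟩, hz⟩ := Filter.nonempty_of_mem (inter_mem h self_mem_nhdsWithin)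
      exact lt_asymm hz (S.F_maps_Ioo v hy).1
    · exact h
  exact not_disj_of_mem (hr w h) (hr w' h') (S.disj_of_length hl hne)

lemma one_unique {w w' : List Λ} (hl : w.length = w'.length) (h : (1:ℝ) ∈ S.F w '' Icc (0:ℝ) 1)
    (h' : (1:ℝ) ∈ S.F w' '' Icc (0:ℝ) 1) : w = w' := by
  by_contra hne
  have hr : ∀ v : List Λ, (1:ℝ) ∈ S.F v '' Icc (0:ℝ) 1 →
      S.F v '' Ioo 0 1 ∈ nhdsWithin (1:ℝ) (Iio 1) := by
    intro v hv
    rcases S.side v hv with h | h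
    · exact h
    · exfalso
      obtain ⟨_, ⟨y, hy, rfl⟩, hz⟩ := Filter.nonempty_of_mem (inter_mem h self_mem_nhdsWithin)
      exact lt_asymm hz (S.F_maps_Ioo v hy).2
  exact not_disj_of_mem (hr w h) (hr w' h') (S.disj_of_length hl hne)

lemma inner_word {a b : Λ} (hab : a ≠ b) : ∃ (v : List Λ) (δ κv : ℝ), 0 < δ ∧ 0 < κv ∧
    ∀ x ∈ Icc (0:ℝ) 1, S.F v x ∈ Icc δ (1 - δ) ∧ κv ≤ S.D v x := by
  have hv : ∃ v : List Λ, (0:ℝ) ∉ S.F v '' Icc (0:ℝ) 1 ∧ (1:ℝ) ∉ S.F v '' Icc (0:ℝ) 1 := by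
    by_contra! hc
    have n1 : [a, a] ≠ [a, b] := by simpa using hab
    have n2 : [a, a] ≠ [b, b] := by simpa using hab
    have n3 : [a, b] ≠ [b, b] := by simpa using hab
    have c1 := hc [a, a]
    have c2 := hc [a, b]
    have c3 := hc [b, b]
    by_cases z1 : (0:ℝ) ∈ S.F [a, a] '' Icc (0:ℝ) 1
    · have z2 : (0:ℝ) ∉ S.F [a, b] '' Icc (0:ℝ) 1 := fun h => n1 (S.zero_unique rfl z1 h)
      have z3 : (0:ℝ) ∉ S.F [b, b] '' Icc (0:ℝ) 1 := fun h => n2 (S.zero_unique rfl z1 h)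
      exact n3 (S.one_unique rfl (c2 z2) (c3 z3))
    · by_cases z2 : (0:ℝ) ∈ S.F [a, b] '' Icc (0:ℝ) 1
      · have z3 : (0:ℝ) ∉ S.F [b, b] '' Icc (0:ℝ) 1 := fun h => n3 (S.zero_unique rfl z2 h)
        exact n2 (S.one_unique rfl (c1 z1) (c3 z3))
      · exact n1 (S.one_unique rfl (c1 z1) (c2 z2))
  obtain ⟨v, h0, h1⟩ := hv
  have hne : (Icc (0:ℝ) 1).Nonempty := ⟨0, zero_mem⟩
  obtain ⟨x0, hx0, hmin⟩ := isCompact_Icc.exists_isMinOn hne (S.F_cont v)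
  obtain ⟨x1, hx1, hmax⟩ := isCompact_Icc.exists_isMaxOn hne (S.F_cont v)
  obtain ⟨x2, hx2, hmin2⟩ := isCompact_Icc.exists_isMinOn hne (S.D_cont v)
  have p0 : 0 < S.F v x0 := lt_of_le_of_ne (S.F_maps v hx0).1 fun h => h0 ⟨x0, hx0, h.symm⟩
  have p1 : S.F v x1 < 1 := lt_of_le_of_ne (S.F_maps v hx1).2 fun h => h1 ⟨x1, hx1, h⟩
  refine ⟨v, min (S.F v x0) (1 - S.F v x1), S.D v x2, lt_min p0 (by linarith), S.D_pos v hx2,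
    fun x hx => ⟨⟨(min_le_left _ _).trans (hmin hx), ?_⟩, hmin2 hx⟩⟩
  have a1 := min_le_right (S.F v x0) (1 - S.F v x1)
  have a2 : S.F v x ≤ S.F v x1 := hmax hx
  linarith

lemma evper_countable [Finite Λ] :
    {ω : ℕ → Λ | ∃ N p, 0 < p ∧ ∀ k ≥ N, ω (k + p) = ω k}.Countable := by
  have h : {ω : ℕ → Λ | ∃ N p, 0 < p ∧ ∀ k ≥ N, ω (k + p) = ω k} =
      ⋃ N : ℕ, ⋃ p : ℕ, {ω : ℕ → Λ | 0 < p ∧ ∀ k ≥ N, ω (k + p) = ω k} := by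
    ext ω; simp
  rw [h]
  refine countable_iUnion fun N => countable_iUnion fun p => ?_
  have : Countable Λ := Finite.to_countable
  refine MapsTo.countable_of_injOn (f := fun ω => seg ω 0 (N + p)) (t := univ)
    (fun _ _ => mem_univ _) ?_ (to_countable _)
  rintro ω ⟨hp, hω⟩ σ ⟨_, hσ⟩ e
  have e' := (seg_eq_iff ω σ 0 0 (N + p)).1 e
  funext k
  induction k using Nat.strong_induction_on with
  | _ k ih =>
    by_cases hk : k < N + p
    · simpa using e' k hk
    · have h1 := hω (k - p) (by omega)
      have h2 := hσ (k - p) (by omega)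
      rw [show k - p + p = k by omega] at h1 h2
      rw [h1, h2]
      exact ih _ (by omega)

lemma coding {X : Set ℝ} (hXsub : X ⊆ Icc 0 1) (hX : ∀ x ∈ X, ∃ a, ∃ y ∈ X, S.f a y = x)
    {x : ℝ} (hx : x ∈ X) : ∃ ω, S.Cod ω x := by
  choose a y hy hay using hX
  let g : X → X := fun z => ⟨y z.1 z.2, hy z.1 z.2⟩
  let orb : X → ℕ → Λ := fun z n => a (g^[n] z).1 (g^[n] z).2
  have key : ∀ n (z : X), S.F (seg (orb z) 0 n) (g^[n] z).1 = z.1 := by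
    intro n
    induction n with
    | zero => intro z; rfl
    | succ n ih =>
      intro z
      have e : seg (orb z) (0 + 1) n = seg (orb (g z)) 0 n := by
        rw [seg_eq_iff]; intro k _
        rw [show 0 + 1 + k = k + 1 by ring, zero_add]; rfl
      rw [seg_succ, e, F_cons, Function.iterate_succ_apply, ih]
      exact hay z.1 z.2
  refine ⟨orb ⟨x, hx⟩, fun n => ⟨_, hXsub (g^[n] ⟨x, hx⟩).2, key n ⟨x, hx⟩⟩⟩

theorem main [Fintype Λ] (hcard : 2 ≤ Fintype.card Λ) {X : Set ℝ} (hXne : X.Nonempty)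
    (hXc : IsCompact X) (hXsub : X ⊆ Icc 0 1) (hXinv : X = ⋃ i, S.f i '' X) :
    dimH (bad1 ∩ X) = dimH X := by
  refine le_antisymm (dimH_mono inter_subset_right) ?_
  have hmaps : ∀ a, MapsTo (S.f a) X X := by
    intro a x hx
    rw [hXinv]
    exact mem_iUnion.2 ⟨a, x, hx, rfl⟩
  have hback : ∀ x ∈ X, ∃ a, ∃ y ∈ X, S.f a y = x := by
    intro x hx
    rw [hXinv] at hx
    obtain ⟨a, y, hy, e⟩ := mem_iUnion.1 hx
    exact ⟨a, y, hy, e⟩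
  obtain ⟨a, b, hab⟩ := Fintype.exists_pair_of_one_lt_card (α := Λ) (by omega)
  obtain ⟨v, δ, κv, hδ, hκv, hv⟩ := S.inner_word hab
  set P := S.pt '' {ω : ℕ → Λ | ∃ N p, 0 < p ∧ ∀ k ≥ N, ω (k + p) = ω k} with hP
  have hPc : P.Countable := evper_countable.image _
  have hcover : X ⊆ P ∪ ⋃ n : ℕ, S.XD ((n : ℝ) + 1) := by
    intro x hx
    obtain ⟨ω, hω⟩ := S.coding hXsub hback hx
    by_cases hev : ∃ N p, 0 < p ∧ ∀ k ≥ N, ω (k + p) = ω k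
    · exact Or.inl ⟨ω, hev, S.cod_unique (S.pt_cod ω) hω⟩
    · right
      obtain ⟨Dc, hDc⟩ := S.claimM' hev
      obtain ⟨n, hn⟩ := exists_nat_ge Dc
      refine mem_iUnion.2 ⟨n, ω, hω, hDc.mono fun m hm x hx y hy => (hm x hx y hy).trans ?_⟩
      exact mul_le_mul_of_nonneg_right (by linarith) (S.D_pos _ hy).le
  by_contra hlt
  rw [not_le] at hlt
  obtain ⟨s1, hs1, hs1'⟩ := ENNReal.lt_iff_exists_nnreal_btwn.1 hlt
  obtain ⟨s2, hs2, hs2'⟩ := ENNReal.lt_iff_exists_nnreal_btwn.1 hs1'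
  have hs1pos : 0 < s1 := by
    have := lt_of_le_of_lt zero_le hs1
    exact_mod_cast this
  have hs12 : (s1 : ℝ) < s2 := by exact_mod_cast hs2
  have hdim := dimH_mono hcover
  rw [dimH_union, dimH_countable hPc, dimH_iUnion] at hdim
  have h2 : (s2 : ℝ≥0∞) < ⨆ n : ℕ, dimH (S.XD ((n : ℝ) + 1)) := by
    have := lt_of_lt_of_le hs2' hdim
    simpa using this
  obtain ⟨n, hn⟩ := lt_iSup_iff.1 h2
  set D0 : ℝ := (n : ℝ) + 1 with hD0
  have hD01 : 1 ≤ D0 := by rw [hD0]; linarith [(Nat.cast_nonneg n : (0:ℝ) ≤ n)]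
  have hD0pos : 0 < D0 := by linarith
  set β : ℝ := (κv / (2 * D0)) ^ (s1 : ℝ) with hβ
  have hβ0 : 0 < β := by positivity
  obtain ⟨K, hK⟩ := exists_pow_lt_of_lt_one (show (0:ℝ) < 1 / (2 * D0) by positivity)
    (show (1 / 2 : ℝ) < 1 by norm_num)
  obtain ⟨k, hk, W, hW, hdis, hM⟩ := S.upper hD01 hs12 hn (4 + 2 / β) K
  set r : ℝ := (1 / 2 : ℝ) ^ k with hr
  have hr0 : 0 < r := by positivity
  have hr1 : r ≤ 1 := pow_le_one₀ (by norm_num) (by norm_num)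
  have hrs0 : 0 < r ^ (s1 : ℝ) := by positivity
  have hrs : r ^ (s1 : ℝ) ≤ 1 := Real.rpow_le_one hr0.le hr1 s1.coe_nonneg
  have hrK : D0 * r ≤ 1 / 2 := by
    have h1 : r ≤ (1 / 2 : ℝ) ^ K := pow_le_pow_of_le_one (by norm_num) (by norm_num) hk
    have h3 : r ≤ 1 / (2 * D0) := by linarith
    rw [le_div_iff₀ (by positivity)] at h3
    linarith
  have h2β : 0 < 2 / β := by positivity
  have hW4 : (4:ℝ) < W.card := by
    have h1 : (W.card : ℝ) * r ^ (s1 : ℝ) ≤ W.card := mul_le_of_le_one_right (Nat.cast_nonneg _) hrs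
    linarith
  have hW4' : 4 < W.card := by exact_mod_cast hW4
  have hN : ((W.card - 2 : ℕ) : ℝ) = W.card - 2 := by
    rw [Nat.cast_sub (by omega)]; norm_num
  refine absurd hs1 (not_lt.2 ?_)
  refine S.bad_dim hXne hXc hXsub hmaps hδ (fun x hx => (hv x hx).1) hκv (fun x hx => (hv x hx).2)
    (κ := r / (2 * D0)) (by positivity) (W := W) (fun w hw x hx => ?_) hdis
    (N := W.card - 2) (by omega) (by omega) hs1pos ?_
  · exact ⟨(hW w hw x hx).1, (hW w hw x hx).2.trans hrK⟩
  · rw [hN, show r / (2 * D0) * κv = r * (κv / (2 * D0)) by ring,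
      Real.mul_rpow hr0.le (by positivity), ← hβ]
    have h1 : 2 / β < W.card * r ^ (s1 : ℝ) := by linarith
    rw [div_lt_iff₀ hβ0] at h1
    have h3 : (W.card : ℝ) / 2 ≤ W.card - 2 := by linarith
    have h4 : (W.card : ℝ) / 2 * (r ^ (s1 : ℝ) * β) ≤ (W.card - 2) * (r ^ (s1 : ℝ) * β) :=
      mul_le_mul_of_nonneg_right h3 (by positivity)
    linarith

end PSys

lemma abs_deriv_le_one {f : ℝ → ℝ} {d x : ℝ} (hx : x ∈ Icc (0:ℝ) 1)
    (hcontr : ∀ x ∈ Icc (0:ℝ) 1, ∀ y ∈ Icc (0:ℝ) 1, x ≠ y → |f x - f y| < |x - y|)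
    (hd : HasDerivWithinAt f d (Icc (0:ℝ) 1) x) : |d| ≤ 1 := by
  have hne : (nhdsWithin x (Icc (0:ℝ) 1 \ {x})).NeBot := by
    have := uniqueDiffWithinAt_iff_accPt.1 (uniqueDiffOn_Icc zero_lt_one x hx)
    rwa [accPt_principal_iff_nhdsWithin] at this
  refine le_of_tendsto (hasDerivWithinAt_iff_tendsto_slope.1 hd).abs ?_
  filter_upwards [self_mem_nhdsWithin] with y hy
  have hyx : x ≠ y := fun h => hy.2 h.symm
  rw [slope_def_field, abs_div]
  have h1 := hcontr y hy.1 x hx hyx.symm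
  exact div_le_one_of_le₀ h1.le (abs_nonneg _)

theorem stmt13 {Λ : Type} [Fintype Λ] (hcard : 2 ≤ Fintype.card Λ)
    (f : Λ → ℝ → ℝ)
    (hmaps : ∀ i, MapsTo (f i) (Icc (0:ℝ) 1) (Icc (0:ℝ) 1))
    (hC2 : ∀ i, ContDiffOn ℝ 2 (f i) (Icc (0:ℝ) 1))
    (hnv : ∀ i, ∀ x ∈ Icc (0:ℝ) 1, derivWithin (f i) (Icc (0:ℝ) 1) x ≠ 0)
    (hcontr : ∀ i, ∀ x ∈ Icc (0:ℝ) 1, ∀ y ∈ Icc (0:ℝ) 1, x ≠ y → |f i x - f i y| < |x - y|)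
    (hpar : ∃ i, ∃ p ∈ Icc (0:ℝ) 1, f i p = p ∧ |derivWithin (f i) (Icc (0:ℝ) 1) p| = 1)
    (hosc1 : ∀ i, f i '' Ioo (0:ℝ) 1 ⊆ Ioo (0:ℝ) 1)
    (hosc2 : Pairwise fun i i' => Disjoint (f i '' Ioo (0:ℝ) 1) (f i' '' Ioo (0:ℝ) 1))
    (X : Set ℝ) (hXne : X.Nonempty) (hXc : IsCompact X) (hXsub : X ⊆ Icc 0 1)
    (hXinv : X = ⋃ i, f i '' X) :
    dimH (bad1 ∩ X) = dimH X := by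
  have hud : UniqueDiffOn ℝ (Icc (0:ℝ) 1) := uniqueDiffOn_Icc zero_lt_one
  have hd : ∀ i, ∀ x ∈ Icc (0:ℝ) 1,
      HasDerivWithinAt (f i) (derivWithin (f i) (Icc (0:ℝ) 1) x) (Icc (0:ℝ) 1) x := fun i x hx =>
    ((hC2 i).differentiableOn (by norm_num) x hx).hasDerivWithinAt
  have hd1 : ∀ i, ContDiffOn ℝ 1 (derivWithin (f i) (Icc (0:ℝ) 1)) (Icc (0:ℝ) 1) := fun i =>
    (hC2 i).derivWithin hud (by norm_num)
  have hlip : ∀ i, ∃ K : ℝ≥0, LipschitzOnWith K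
      (fun x => Real.log (derivWithin (f i) (Icc (0:ℝ) 1) x)) (Icc (0:ℝ) 1) := fun i =>
    ((hd1 i).log (hnv i)).exists_lipschitzOnWith one_ne_zero (convex_Icc 0 1) isCompact_Icc
  choose K hK using hlip
  let S : PSys Λ :=
    { f := f
      d := fun i => derivWithin (f i) (Icc (0:ℝ) 1)
      C := ∑ i, (K i : ℝ)
      C_nonneg := Finset.sum_nonneg fun i _ => (K i).coe_nonneg
      maps := hmaps
      hd := hd
      dne := hnv
      dle := fun i x hx => abs_deriv_le_one hx (hcontr i) (hd i x hx)
      dcont := fun i => (hd1 i).continuousOn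
      dlog := by
        intro i x hx y hy
        rw [Real.log_abs, Real.log_abs]
        have h1 := (hK i).dist_le_mul x hx y hy
        rw [Real.dist_eq, Real.dist_eq] at h1
        refine h1.trans (mul_le_mul_of_nonneg_right ?_ (abs_nonneg _))
        exact Finset.single_le_sum (f := fun i => (K i : ℝ)) (fun i _ => (K i).coe_nonneg)
          (Finset.mem_univ i)
      contr := hcontr
      osc1 := fun i x hx => hosc1 i ⟨x, hx, rfl⟩
      osc2 := hosc2 }
  exact S.main hcard hXne hXc hXsub hXinv
end
end
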